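/- Let X be an irreducible plane quartic whose singular locus consists of exactly three ordinary nodes and no other singular points (a trinodal quartic). Then X has exactly 4 theta-lines of type 0 (bitangents), exactly 6 theta-lines of type 1 (two through each node), and exactly 3 theta-lines of type 2, namely the three lines joining pairs of nodes. -/

import Mathlib

open MvPolynomial

noncomputable section

abbrev P2 : Type := Projectivization ℂ (Fin 3 → ℂ)

/-- The zero locus in `ℙ²` of a polynomial `F`: the points all of whose
representative vectors are zeros of `F`. -/
def curve (F : MvPolynomial (Fin 3) ℂ) : Set P2 :=
  {p | ∀ (w : Fin 3 → ℂ) (hw : w ≠ 0), Projectivization.mk ℂ w hw = p → eval w F = 0}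

/-- The projective line spanned by two vectors. -/
def lineThrough (u v : Fin 3 → ℂ) : Set P2 :=
  {p | ∃ s t : ℂ, ∃ h : s • u + t • v ≠ 0, p = Projectivization.mk ℂ (s • u + t • v) h}

/-- A subset of `ℙ²` is a line if it is the projective span of two
linearly independent vectors. -/
def IsLine (S : Set P2) : Prop :=
  ∃ u v : Fin 3 → ℂ, LinearIndependent ℂ ![u, v] ∧ S = lineThrough u v

/-- The restriction of `F` to the affine parametrization `t ↦ a + t • b` of the line
through `[a]` and `[b]`, as a polynomial in `t`. -/
def lineRest (F : MvPolynomial (Fin 3) ℂ) (a b : Fin 3 → ℂ) : Polynomial ℂ :=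
  eval₂ Polynomial.C (fun i => Polynomial.C (a i) + Polynomial.X * Polynomial.C (b i)) F

/-- The local intersection multiplicity, at the point `[a]`, of the curve `F = 0` with the
line through `[a]` and `[b]` (parametrized by `t ↦ a + t • b`, the point `[a]`
corresponding to `t = 0`). -/
def multAt (F : MvPolynomial (Fin 3) ℂ) (a b : Fin 3 → ℂ) : ℕ :=
  Polynomial.rootMultiplicity 0 (lineRest F a b)

/-- The scheme `X ∩ L` (for `X = {F = 0}`, `L` a line) is everywhere nonreduced: at each
point of `X ∩ L` the local intersection multiplicity is at least `2`.  (Stated over all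
parametrizations of `L`; the base point `a` of a parametrization is a point of `L`, and
every point of `L` occurs as such a base point.) -/
def EverywhereTangent (F : MvPolynomial (Fin 3) ℂ) (S : Set P2) : Prop :=
  ∀ a b : Fin 3 → ℂ, LinearIndependent ℂ ![a, b] → S = lineThrough a b →
    ∀ ha : a ≠ 0, Projectivization.mk ℂ a ha ∈ curve F → 2 ≤ multAt F a b

/-- A theta-line of the quartic `F`: either contained in the curve, or intersecting it
everywhere nonreducedly. -/
def ThetaLine (F : MvPolynomial (Fin 3) ℂ) (S : Set P2) : Prop :=
  IsLine S ∧ (S ⊆ curve F ∨ EverywhereTangent F S)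

/-- A bitangent line of (a smooth curve) `F = 0`: a line, not contained in the curve,
whose scheme-theoretic intersection with the curve is everywhere nonreduced. -/
def Bitangent (F : MvPolynomial (Fin 3) ℂ) (S : Set P2) : Prop :=
  IsLine S ∧ ¬ S ⊆ curve F ∧ EverywhereTangent F S

/-- The line `S` is tangent to the curve `F = 0` at the point `q`: the local intersection
multiplicity there is at least `2`. -/
def TangentAt (F : MvPolynomial (Fin 3) ℂ) (S : Set P2) (q : P2) : Prop :=
  IsLine S ∧ q ∈ S ∧ q ∈ curve F ∧
    ∀ a b : Fin 3 → ℂ, LinearIndependent ℂ ![a, b] → S = lineThrough a b →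
      ∀ ha : a ≠ 0, Projectivization.mk ℂ a ha = q → 2 ≤ multAt F a b

/-- The curve `F = 0` is smooth: `F` and its partial derivatives have no common
projective zero. -/
def SmoothCurve (F : MvPolynomial (Fin 3) ℂ) : Prop :=
  ∀ w : Fin 3 → ℂ, w ≠ 0 → ¬ (eval w F = 0 ∧ ∀ i : Fin 3, eval w (pderiv i F) = 0)

/-- Iterated partial derivative along a list of coordinate directions. -/
def pderivList (l : List (Fin 3)) (F : MvPolynomial (Fin 3) ℂ) : MvPolynomial (Fin 3) ℂ :=
  l.foldr (fun i G => pderiv i G) F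

/-- `F` vanishes to order at least `m` at the point `p` (all partial derivatives of
order `< m` vanish at `p`); i.e. `p` is a point of multiplicity at least `m` of `F = 0`. -/
def VanishesToOrder (F : MvPolynomial (Fin 3) ℂ) (p : P2) (m : ℕ) : Prop :=
  ∀ l : List (Fin 3), l.length < m →
    ∀ (w : Fin 3 → ℂ) (hw : w ≠ 0), Projectivization.mk ℂ w hw = p →
      eval w (pderivList l F) = 0

/-- `p` is a singular point of the curve `F = 0`. -/
def IsSingularAt (F : MvPolynomial (Fin 3) ℂ) (p : P2) : Prop :=
  VanishesToOrder F p 2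

/-- `p` is a double point: a point of multiplicity exactly `2`. -/
def IsDoublePoint (F : MvPolynomial (Fin 3) ℂ) (p : P2) : Prop :=
  VanishesToOrder F p 2 ∧ ¬ VanishesToOrder F p 3

/-- The quadratic form (in the direction `b`) cutting out the tangent cone of `F = 0`
at the double point `[a]`: the degree-`2` Taylor coefficient of `t ↦ F (a + t • b)`. -/
def coneCoeff (F : MvPolynomial (Fin 3) ℂ) (a b : Fin 3 → ℂ) : ℂ :=
  (lineRest F a b).coeff 2

/-- `p` is an ordinary node: a double point whose tangent cone consists of two distinct
lines, i.e. the tangent-cone quadratic has two null directions independent modulo `a`. -/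
def OrdinaryNode (F : MvPolynomial (Fin 3) ℂ) (p : P2) : Prop :=
  IsDoublePoint F p ∧
    ∀ (a : Fin 3 → ℂ) (ha : a ≠ 0), Projectivization.mk ℂ a ha = p →
      ∃ b₁ b₂ : Fin 3 → ℂ, LinearIndependent ℂ ![a, b₁, b₂] ∧
        coneCoeff F a b₁ = 0 ∧ coneCoeff F a b₂ = 0

/-- At the double point `[a]`, the tangent cone is the double line through `[a]` and
`[b₀]`: `b₀` is a null direction of the tangent-cone quadratic, and every null
direction lies on the line spanned by `a` and `b₀`. -/
def DoubleLineCone (F : MvPolynomial (Fin 3) ℂ) (a b₀ : Fin 3 → ℂ) : Prop :=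
  LinearIndependent ℂ ![a, b₀] ∧ coneCoeff F a b₀ = 0 ∧
    ∀ b : Fin 3 → ℂ, coneCoeff F a b = 0 → b ∈ Submodule.span ℂ ({a, b₀} : Set (Fin 3 → ℂ))

/-- `p` is an ordinary cusp: a double point whose tangent cone is a double line `L₀`
with local intersection multiplicity `i(L₀ · X) = 3` at `p`. -/
def OrdinaryCusp (F : MvPolynomial (Fin 3) ℂ) (p : P2) : Prop :=
  IsDoublePoint F p ∧
    ∀ (a : Fin 3 → ℂ) (ha : a ≠ 0), Projectivization.mk ℂ a ha = p →
      ∃ b₀ : Fin 3 → ℂ, DoubleLineCone F a b₀ ∧ multAt F a b₀ = 3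

/-- `p` is an ordinary tacnode: a double point whose tangent cone is a double line `L₀`
with local intersection multiplicity `i(L₀ · X) = 4` at `p`. -/
def OrdinaryTacnode (F : MvPolynomial (Fin 3) ℂ) (p : P2) : Prop :=
  IsDoublePoint F p ∧
    ∀ (a : Fin 3 → ℂ) (ha : a ≠ 0), Projectivization.mk ℂ a ha = p →
      ∃ b₀ : Fin 3 → ℂ, DoubleLineCone F a b₀ ∧ multAt F a b₀ = 4

/-- A theta-line of type `i`: a theta-line, not a component of the curve, containing
exactly `i` singular points of the curve. -/
def ThetaLineOfType (F : MvPolynomial (Fin 3) ℂ) (i : ℕ) (S : Set P2) : Prop :=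
  ThetaLine F S ∧ ¬ S ⊆ curve F ∧ {p | p ∈ S ∧ IsSingularAt F p}.ncard = i

/-- Three points of `ℙ²` are collinear. -/
def Collin (p q r : P2) : Prop :=
  ∃ S : Set P2, IsLine S ∧ p ∈ S ∧ q ∈ S ∧ r ∈ S

/-- An ordinary bitangent: a bitangent meeting the curve at exactly two distinct points,
each with local intersection multiplicity exactly `2`. -/
def OrdinaryBitangent (F : MvPolynomial (Fin 3) ℂ) (S : Set P2) : Prop :=
  Bitangent F S ∧ (S ∩ curve F).ncard = 2 ∧
    ∀ a b : Fin 3 → ℂ, LinearIndependent ℂ ![a, b] → S = lineThrough a b →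
      ∀ ha : a ≠ 0, Projectivization.mk ℂ a ha ∈ curve F → multAt F a b = 2

/-- A bitangent meeting the curve only at smooth points. -/
def SmoothBitangent (F : MvPolynomial (Fin 3) ℂ) (S : Set P2) : Prop :=
  Bitangent F S ∧ ∀ p ∈ S ∩ curve F, ¬ IsSingularAt F p

/-! ### Expansions of a quartic form in coordinates -/

theorem exists_quartic_expansion {F : MvPolynomial (Fin 3) ℂ} (hF : F.IsHomogeneous 4)
    (a b c : Fin 3 → ℂ) : ∃ k : ℕ → ℕ → ℕ → ℂ, ∀ x y z : ℂ,
      eval (x • a + y • b + z • c) F =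
        k 4 0 0 * x ^ 4 + k 0 4 0 * y ^ 4 + k 0 0 4 * z ^ 4 +
        k 3 1 0 * x ^ 3 * y + k 3 0 1 * x ^ 3 * z + k 1 3 0 * x * y ^ 3 +
        k 0 3 1 * y ^ 3 * z + k 1 0 3 * x * z ^ 3 + k 0 1 3 * y * z ^ 3 +
        k 2 2 0 * x ^ 2 * y ^ 2 + k 2 0 2 * x ^ 2 * z ^ 2 + k 0 2 2 * y ^ 2 * z ^ 2 +
        k 2 1 1 * x ^ 2 * y * z + k 1 2 1 * x * y ^ 2 * z + k 1 1 2 * x * y * z ^ 2 := by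
  set g : Fin 3 → MvPolynomial (Fin 3) ℂ := fun i => C (a i) * X 0 + C (b i) * X 1 + C (c i) * X 2
  set G : MvPolynomial (Fin 3) ℂ := aeval g F with hG
  have hGh : G.IsHomogeneous 4 := by
    have := hF.aeval g (n := 1) fun i =>
      (((isHomogeneous_X ℂ 0).C_mul (a i)).add ((isHomogeneous_X ℂ 1).C_mul (b i))).add
        ((isHomogeneous_X ℂ 2).C_mul (c i))
    rwa [one_mul] at this
  have heval : ∀ x y z : ℂ, eval (x • a + y • b + z • c) F = eval ![x, y, z] G := by
    intro x y z
    rw [hG, ← MvPolynomial.coe_aeval_eq_eval, ← MvPolynomial.coe_aeval_eq_eval]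
    simp only [RingHom.coe_coe]
    rw [← AlgHom.comp_apply, MvPolynomial.comp_aeval]
    congr 2
    ext i
    simp [g, mul_comm]
  refine ⟨fun i j l => coeff (Finsupp.equivFunOnFinite.symm ![i, j, l]) G, fun x y z => ?_⟩
  have hsum : eval ![x, y, z] G = ∑ d ∈ (Finset.piAntidiag Finset.univ 4 : Finset (Fin 3 → ℕ)),
      coeff (Finsupp.equivFunOnFinite.symm d) G * ∏ i, ![x, y, z] i ^ d i := by
    rw [eval_eq']
    refine Eq.trans ?_ (Finset.sum_map (Finset.piAntidiag Finset.univ 4)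
      Finsupp.equivFunOnFinite.symm.toEmbedding
      (fun d : Fin 3 →₀ ℕ => coeff d G * ∏ i, ![x, y, z] i ^ d i))
    refine Finset.sum_subset (fun d hd => ?_) fun d _ hd => ?_
    · have hdeg := hGh.degree_eq_sum_deg_support hd
      refine Finset.mem_map.2 ⟨d, ?_, by simp⟩
      simp only [Finset.mem_piAntidiag, Finset.mem_univ, implies_true, and_true]
      exact (Finsupp.sum_fintype d (fun _ n => n) (by simp)).symm.trans hdeg.symm
    · rw [notMem_support_iff.1 hd, zero_mul]
  have hset : (Finset.piAntidiag Finset.univ 4 : Finset (Fin 3 → ℕ)) =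
      {![4,0,0], ![0,4,0], ![0,0,4], ![3,1,0], ![3,0,1], ![1,3,0], ![0,3,1], ![1,0,3],
        ![0,1,3], ![2,2,0], ![2,0,2], ![0,2,2], ![2,1,1], ![1,2,1], ![1,1,2]} := by decide
  rw [heval, hsum, hset]
  repeat rw [Finset.sum_insert (by decide)]
  rw [Finset.sum_singleton]
  simp only [Fin.prod_univ_three, Matrix.cons_val]
  ring

theorem exists_binary_expansion {F : MvPolynomial (Fin 3) ℂ} (hF : F.IsHomogeneous 4)
    (a b : Fin 3 → ℂ) : ∃ c₀ c₁ c₂ c₃ c₄ : ℂ, ∀ s t : ℂ, eval (s • a + t • b) F =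
      c₀ * s ^ 4 + c₁ * s ^ 3 * t + c₂ * s ^ 2 * t ^ 2 + c₃ * s * t ^ 3 + c₄ * t ^ 4 := by
  obtain ⟨k, hk⟩ := exists_quartic_expansion hF a b 0
  refine ⟨k 4 0 0, k 3 1 0, k 2 2 0, k 1 3 0, k 0 4 0, fun s t => ?_⟩
  have := hk s t 0
  simp only [smul_zero, add_zero] at this
  rw [this]
  ring

theorem eval_zero_of_quartic {F : MvPolynomial (Fin 3) ℂ} (hF : F.IsHomogeneous 4) :
    eval 0 F = 0 := by
  obtain ⟨c₀, c₁, c₂, c₃, c₄, h⟩ := exists_binary_expansion hF 0 0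
  simpa using h 0 0

theorem eval_smul_of_quartic {F : MvPolynomial (Fin 3) ℂ} (hF : F.IsHomogeneous 4) (r : ℂ)
    (a : Fin 3 → ℂ) : eval (r • a) F = r ^ 4 * eval a F := by
  obtain ⟨c₀, c₁, c₂, c₃, c₄, h⟩ := exists_binary_expansion hF a 0
  have h1 := h 1 0
  have h2 := h r 0
  simp only [smul_zero, add_zero, one_smul] at h1 h2
  rw [h1, h2]
  ring

/-! ### The restriction of a polynomial to a parametrized line -/

theorem eval_lineRest (F : MvPolynomial (Fin 3) ℂ) (a b : Fin 3 → ℂ) (t : ℂ) :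
    (lineRest F a b).eval t = eval (a + t • b) F := by
  unfold lineRest
  rw [← Polynomial.coe_evalRingHom, MvPolynomial.hom_eval₂, ← MvPolynomial.eval₂_id]
  congr 1
  · ext x; simp
  · ext i
    simp only [map_add, map_mul, Polynomial.coe_evalRingHom, Polynomial.eval_C,
      Polynomial.eval_X, Pi.add_apply, Pi.smul_apply, smul_eq_mul]

theorem lineRest_eq_of_eval {F : MvPolynomial (Fin 3) ℂ} {a b : Fin 3 → ℂ} {p : Polynomial ℂ}
    (h : ∀ t : ℂ, eval (a + t • b) F = p.eval t) : lineRest F a b = p :=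
  Polynomial.funext fun t => by rw [eval_lineRest, h]

theorem lineRest_coeff {F : MvPolynomial (Fin 3) ℂ} {a b : Fin 3 → ℂ} {k₀ k₁ k₂ k₃ k₄ : ℂ}
    (h : ∀ t : ℂ, eval (a + t • b) F = k₀ + k₁ * t + k₂ * t ^ 2 + k₃ * t ^ 3 + k₄ * t ^ 4) :
    (lineRest F a b).coeff 0 = k₀ ∧ (lineRest F a b).coeff 1 = k₁ ∧
      (lineRest F a b).coeff 2 = k₂ ∧ (lineRest F a b).coeff 3 = k₃ ∧
      (lineRest F a b).coeff 4 = k₄ := by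
  rw [lineRest_eq_of_eval (p := Polynomial.C k₀ + Polynomial.C k₁ * Polynomial.X +
    Polynomial.C k₂ * Polynomial.X ^ 2 + Polynomial.C k₃ * Polynomial.X ^ 3 +
    Polynomial.C k₄ * Polynomial.X ^ 4) (fun t => by rw [h]; simp)]
  simp [Polynomial.coeff_X, Polynomial.coeff_C, Polynomial.coeff_X_pow]

theorem lineRest_coeff_zero (F : MvPolynomial (Fin 3) ℂ) (a b : Fin 3 → ℂ) :
    (lineRest F a b).coeff 0 = eval a F := by
  rw [Polynomial.coeff_zero_eq_eval_zero, eval_lineRest, zero_smul, add_zero]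

theorem lineRest_coeff_one (F : MvPolynomial (Fin 3) ℂ) (a b : Fin 3 → ℂ) :
    (lineRest F a b).coeff 1 = ∑ i, b i * eval a (pderiv i F) := by
  induction F using MvPolynomial.induction_on with
  | C r => simp [lineRest]
  | add p q hp hq =>
    have : lineRest (p + q) a b = lineRest p a b + lineRest q a b := by simp [lineRest]
    rw [this, Polynomial.coeff_add, hp, hq, ← Finset.sum_add_distrib]
    exact Finset.sum_congr rfl fun i _ => by simp [mul_add]
  | mul_X p j hp =>
    have : lineRest (p * X j) a b =
        lineRest p a b * (Polynomial.C (a j) + Polynomial.X * Polynomial.C (b j)) := by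
      simp [lineRest]
    rw [this, Polynomial.mul_coeff_one, hp, lineRest_coeff_zero]
    fin_cases j <;> simp [Fin.sum_univ_three, pderiv_X, Pi.single_apply] <;> ring

theorem IsSingularAt.lineRest_coeff {F : MvPolynomial (Fin 3) ℂ} {a : Fin 3 → ℂ} {ha : a ≠ 0}
    (h : IsSingularAt F (Projectivization.mk ℂ a ha)) (b : Fin 3 → ℂ) :
    (lineRest F a b).coeff 0 = 0 ∧ (lineRest F a b).coeff 1 = 0 := by
  have h0 := h [] (by simp) a ha rfl
  have h1 := fun i : Fin 3 => h [i] (by simp) a ha rfl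
  simp only [pderivList, List.foldr] at h0 h1
  simp [lineRest_coeff_zero, lineRest_coeff_one, h0, h1]

/-! ### Consequences of irreducibility -/

theorem false_of_factorization {F : MvPolynomial (Fin 3) ℂ} (hirr : Irreducible F)
    (T : (Fin 3 → ℂ) ≃ₗ[ℂ] (Fin 3 → ℂ)) {H₁ H₂ : MvPolynomial (Fin 3) ℂ}
    (h₁ : eval 0 H₁ = 0) (h₂ : eval 0 H₂ = 0)
    (h : ∀ u, eval (T u) F = eval u H₁ * eval u H₂) : False := by
  let φ : MvPolynomial (Fin 3) ℂ →ₐ[ℂ] MvPolynomial (Fin 3) ℂ :=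
    aeval fun i => ∑ j, C (T.symm (Pi.single j 1) i) * X j
  have hφ : ∀ (H : MvPolynomial (Fin 3) ℂ) u, eval u (φ H) = eval (T.symm u) H := by
    intro H u
    rw [← MvPolynomial.coe_aeval_eq_eval, ← MvPolynomial.coe_aeval_eq_eval]
    simp only [RingHom.coe_coe, φ]
    rw [← AlgHom.comp_apply, MvPolynomial.comp_aeval]
    congr 2
    ext i
    conv_rhs => rw [pi_eq_sum_univ' u, map_sum]
    simp [mul_comm]
  have hF : F = φ H₁ * φ H₂ := MvPolynomial.funext fun u => by
    rw [map_mul, hφ, hφ, ← h, T.apply_symm_apply]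
  have hnot : ∀ H : MvPolynomial (Fin 3) ℂ, eval 0 H = 0 → ¬ IsUnit (φ H) := by
    intro H hH hu
    have := hu.map (eval (0 : Fin 3 → ℂ))
    rw [hφ, map_zero, hH] at this
    exact not_isUnit_zero this
  rcases hirr.isUnit_or_isUnit hF with hu | hu
  · exact hnot _ h₁ hu
  · exact hnot _ h₂ hu

theorem exists_linearEquiv_of_linearIndependent {w₀ w₁ w₂ : Fin 3 → ℂ}
    (hw : LinearIndependent ℂ ![w₀, w₁, w₂]) :
    ∃ T : (Fin 3 → ℂ) ≃ₗ[ℂ] (Fin 3 → ℂ), ∀ u, T u = u 0 • w₀ + u 1 • w₁ + u 2 • w₂ := by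
  let B := basisOfLinearIndependentOfCardEqFinrank hw (by simp)
  refine ⟨B.equivFun.symm, fun u => ?_⟩
  simp [B, Module.Basis.equivFun_symm_apply, Fin.sum_univ_three]

theorem exists_linearIndependent_cons {a b : Fin 3 → ℂ} (h : LinearIndependent ℂ ![a, b]) :
    ∃ c, LinearIndependent ℂ ![c, a, b] := by
  by_contra! hc
  have htop : Submodule.span ℂ (Set.range ![a, b]) = ⊤ := by
    refine eq_top_iff.2 fun c _ => ?_
    by_contra hmem
    exact hc c (h.finCons hmem)
  have := finrank_range_le_card (R := ℂ) ![a, b]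
  rw [Set.finrank, htop] at this
  simp at this

theorem quartic_coeff_eq {c₀ c₁ c₂ c₃ c₄ d₀ d₁ d₂ d₃ d₄ : ℂ}
    (h : ∀ t : ℂ, c₀ + c₁ * t + c₂ * t ^ 2 + c₃ * t ^ 3 + c₄ * t ^ 4 =
      d₀ + d₁ * t + d₂ * t ^ 2 + d₃ * t ^ 3 + d₄ * t ^ 4) :
    c₀ = d₀ ∧ c₁ = d₁ ∧ c₂ = d₂ ∧ c₃ = d₃ ∧ c₄ = d₄ := by
  have h0 := h 0
  have h1 := h 1
  have h2 := h (-1)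
  have h3 := h 2
  have h4 := h (-2)
  refine ⟨?_, ?_, ?_, ?_, ?_⟩ <;> grind

theorem not_vanish_on_line {F : MvPolynomial (Fin 3) ℂ} (hF : F.IsHomogeneous 4)
    (hirr : Irreducible F) {a b : Fin 3 → ℂ} (hab : LinearIndependent ℂ ![a, b])
    (h : ∀ s t : ℂ, eval (s • a + t • b) F = 0) : False := by
  obtain ⟨c, hc⟩ := exists_linearIndependent_cons hab
  obtain ⟨T, hT⟩ := exists_linearEquiv_of_linearIndependent hc
  obtain ⟨k, hk⟩ := exists_quartic_expansion hF c a b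
  have hz : ∀ t : ℂ, k 0 4 0 + k 0 3 1 * t + k 0 2 2 * t ^ 2 + k 0 1 3 * t ^ 3 + k 0 0 4 * t ^ 4 =
      0 + 0 * t + 0 * t ^ 2 + 0 * t ^ 3 + 0 * t ^ 4 := by
    intro t
    have h1 := hk 0 1 t
    rw [zero_smul, zero_add, h] at h1
    linear_combination -h1
  obtain ⟨h0, h1, h2, h3, h4⟩ := quartic_coeff_eq hz
  refine false_of_factorization hirr T (H₁ := X 0)
    (H₂ := C (k 4 0 0) * X 0 ^ 3 + C (k 3 1 0) * X 0 ^ 2 * X 1 + C (k 3 0 1) * X 0 ^ 2 * X 2 +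
      C (k 1 3 0) * X 1 ^ 3 + C (k 1 0 3) * X 2 ^ 3 + C (k 2 2 0) * X 0 * X 1 ^ 2 +
      C (k 2 0 2) * X 0 * X 2 ^ 2 + C (k 2 1 1) * X 0 * X 1 * X 2 + C (k 1 2 1) * X 1 ^ 2 * X 2 +
      C (k 1 1 2) * X 1 * X 2 ^ 2) (by simp) (by simp) fun u => ?_
  rw [hT, hk, h0, h1, h2, h3, h4]
  simp only [map_add, map_mul, map_pow, eval_C, eval_X]
  ring

theorem lineRest_ne_zero {F : MvPolynomial (Fin 3) ℂ} (hF : F.IsHomogeneous 4)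
    (hirr : Irreducible F) {a b : Fin 3 → ℂ} (hab : LinearIndependent ℂ ![a, b]) :
    lineRest F a b ≠ 0 := by
  intro h0
  obtain ⟨c₀, c₁, c₂, c₃, c₄, h⟩ := exists_binary_expansion hF a b
  obtain ⟨k0, k1, k2, k3, k4⟩ := lineRest_coeff (F := F) (a := a) (b := b)
    (k₀ := c₀) (k₁ := c₁) (k₂ := c₂) (k₃ := c₃) (k₄ := c₄) fun t => by
      have := h 1 t
      rw [one_smul] at this
      rw [this]
      ring
  simp only [h0, Polynomial.coeff_zero] at k0 k1 k2 k3 k4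
  refine not_vanish_on_line hF hirr hab fun s t => ?_
  rw [h, ← k0, ← k1, ← k2, ← k3, ← k4]
  ring

/-! ### Everywhere tangent lines and squares of binary quadratic forms -/

theorem exists_sq (z : ℂ) : ∃ w : ℂ, w ^ 2 = z := IsAlgClosed.exists_pow_nat_eq z two_pos

theorem exists_quartic_root {c₀ c₁ c₂ c₃ c₄ : ℂ} (h : c₄ ≠ 0) :
    ∃ t : ℂ, c₀ + c₁ * t + c₂ * t ^ 2 + c₃ * t ^ 3 + c₄ * t ^ 4 = 0 := by
  obtain ⟨t, ht⟩ := IsAlgClosed.exists_root (Polynomial.C c₄ * Polynomial.X ^ 4 +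
    Polynomial.C c₃ * Polynomial.X ^ 3 + Polynomial.C c₂ * Polynomial.X ^ 2 +
    Polynomial.C c₁ * Polynomial.X + Polynomial.C c₀) (by
      have : (Polynomial.C c₄ * Polynomial.X ^ 4 + Polynomial.C c₃ * Polynomial.X ^ 3 +
          Polynomial.C c₂ * Polynomial.X ^ 2 + Polynomial.C c₁ * Polynomial.X +
          Polynomial.C c₀).degree = 4 := by compute_degree!
      rw [this]
      decide)
  refine ⟨t, ?_⟩
  simp only [Polynomial.IsRoot, Polynomial.eval_add, Polynomial.eval_mul, Polynomial.eval_C,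
    Polynomial.eval_pow, Polynomial.eval_X] at ht
  linear_combination ht

/-- If every root of `m t² + n t + l` outside `{0}` is a double root and `m ≠ 0`, then the
discriminant vanishes. -/
theorem discrim_eq_zero_of_roots {l m n : ℂ} (hm : m ≠ 0)
    (h : ∀ t : ℂ, l + n * t + m * t ^ 2 = 0 → t ^ 2 * (n + 2 * m * t) = 0) :
    n ^ 2 = 4 * l * m := by
  obtain ⟨δ, hδ⟩ := exists_sq (n ^ 2 - 4 * l * m)
  have hp := h ((-n + δ) / (2 * m)) (by field_simp; linear_combination hδ)
  have hq := h ((-n - δ) / (2 * m)) (by field_simp; linear_combination hδ)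
  have e1 : n + 2 * m * ((-n + δ) / (2 * m)) = δ := by field_simp; ring
  have e2 : n + 2 * m * ((-n - δ) / (2 * m)) = -δ := by field_simp; ring
  rw [e1] at hp
  rw [e2] at hq
  have hδ0 : δ = 0 := by
    by_contra hne
    simp [hne, hm] at hp hq
    grind
  rw [hδ0] at hδ
  linear_combination -hδ

theorem exists_quadratic_sq_eq {c₀ c₁ c₂ c₃ c₄ : ℂ}
    (h : ∀ t : ℂ, c₀ + c₁ * t + c₂ * t ^ 2 + c₃ * t ^ 3 + c₄ * t ^ 4 = 0 →
      c₁ + 2 * c₂ * t + 3 * c₃ * t ^ 2 + 4 * c₄ * t ^ 3 = 0)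
    (hinf : c₄ = 0 → c₃ = 0) :
    ∃ g₀ g₁ g₂ : ℂ, ∀ s t : ℂ,
      c₀ * s ^ 4 + c₁ * s ^ 3 * t + c₂ * s ^ 2 * t ^ 2 + c₃ * s * t ^ 3 + c₄ * t ^ 4 =
        (g₀ * s ^ 2 + g₁ * s * t + g₂ * t ^ 2) ^ 2 := by
  by_cases h4 : c₄ = 0
  · obtain rfl := hinf h4
    subst h4
    by_cases h2 : c₂ = 0
    · subst h2
      have h1 : c₁ = 0 := by
        by_contra h1
        have := h (-c₀ / c₁) (by field_simp; ring)
        simp at this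
        exact h1 this
      obtain ⟨g, hg⟩ := exists_sq c₀
      exact ⟨g, 0, 0, fun s t => by rw [h1, ← hg]; ring⟩
    · have hd : c₁ ^ 2 = 4 * c₀ * c₂ := discrim_eq_zero_of_roots h2 fun t ht => by
        have := h t (by linear_combination ht)
        linear_combination t ^ 2 * this
      obtain ⟨g, hg⟩ := exists_sq c₂
      refine ⟨g * c₁ / (2 * c₂), g, 0, fun s t => ?_⟩
      have h0 : c₀ = c₁ ^ 2 / (4 * c₂) := by field_simp; linear_combination -hd
      trans g ^ 2 * (c₁ / (2 * c₂) * s ^ 2 + s * t) ^ 2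
      · rw [hg, h0]
        field_simp
        ring
      · ring
  · obtain ⟨r, hr⟩ := exists_quartic_root (c₀ := c₀) (c₁ := c₁) (c₂ := c₂) (c₃ := c₃) h4
    have hr' := h r hr
    obtain ⟨l, hl⟩ : ∃ l, l = c₂ + 3 * c₃ * r + 6 * c₄ * r ^ 2 := ⟨_, rfl⟩
    obtain ⟨n, hn⟩ : ∃ n, n = c₃ + 4 * c₄ * r := ⟨_, rfl⟩
    have hd : n ^ 2 = 4 * l * c₄ := discrim_eq_zero_of_roots h4 fun t ht => by
      have := h (r + t) (by
        rw [hl, hn] at ht; linear_combination hr + t * hr' + t ^ 2 * ht)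
      rw [hl, hn] at ht
      rw [hn]
      linear_combination this - hr' - 2 * t * ht
    obtain ⟨g, hg⟩ := exists_sq c₄
    have hlq : l = n ^ 2 / (4 * c₄) := by field_simp; linear_combination -hd
    have hc₃ : c₃ = n - 4 * c₄ * r := by rw [hn]; ring
    have hc₂ : c₂ = n ^ 2 / (4 * c₄) - 3 * c₃ * r - 6 * c₄ * r ^ 2 := by
      rw [← hlq, hl]; ring
    have hc₁ : c₁ = - (2 * c₂ * r + 3 * c₃ * r ^ 2 + 4 * c₄ * r ^ 3) := by
      linear_combination hr'
    have hc₀ : c₀ = - (c₁ * r + c₂ * r ^ 2 + c₃ * r ^ 3 + c₄ * r ^ 4) := by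
      linear_combination hr
    refine ⟨g * (r ^ 2 - n / (2 * c₄) * r), g * (-2 * r + n / (2 * c₄)), g, fun s t => ?_⟩
    trans g ^ 2 * ((t - r * s) * (t - r * s + n / (2 * c₄) * s)) ^ 2
    · rw [hg, hc₀, hc₁, hc₂, hc₃]
      field_simp
      ring
    · ring

/-! ### Lines in the projective plane -/

theorem mk_mem_lineThrough {a b v : Fin 3 → ℂ} (hv : v ≠ 0) :
    Projectivization.mk ℂ v hv ∈ lineThrough a b ↔ ∃ s t : ℂ, v = s • a + t • b := by
  constructor
  · rintro ⟨s, t, h, he⟩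
    obtain ⟨r, hr⟩ := (Projectivization.mk_eq_mk_iff' ℂ _ _ hv h).1 he
    exact ⟨r * s, r * t, by rw [← hr, smul_add, smul_smul, smul_smul]⟩
  · rintro ⟨s, t, rfl⟩
    exact ⟨s, t, hv, rfl⟩

theorem lineThrough_comm (a b : Fin 3 → ℂ) : lineThrough a b = lineThrough b a := by
  ext p
  induction p using Projectivization.ind with | h v hv =>
  rw [mk_mem_lineThrough, mk_mem_lineThrough, exists_comm]
  simp only [add_comm]

theorem lineThrough_add_smul (a b : Fin 3 → ℂ) (r : ℂ) :
    lineThrough (a + r • b) b = lineThrough a b := by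
  ext p
  induction p using Projectivization.ind with | h v hv =>
  rw [mk_mem_lineThrough, mk_mem_lineThrough]
  constructor
  · rintro ⟨s, t, rfl⟩
    exact ⟨s, s * r + t, by module⟩
  · rintro ⟨s, t, rfl⟩
    exact ⟨s, t - s * r, by module⟩

theorem mk_mem_curve {F : MvPolynomial (Fin 3) ℂ} (hF : F.IsHomogeneous 4) {v : Fin 3 → ℂ}
    (hv : v ≠ 0) : Projectivization.mk ℂ v hv ∈ curve F ↔ eval v F = 0 := by
  refine ⟨fun h => h v hv rfl, fun h w hw he => ?_⟩
  obtain ⟨r, rfl⟩ := (Projectivization.mk_eq_mk_iff' ℂ _ _ hw hv).1 he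
  rw [eval_smul_of_quartic hF, h, mul_zero]

theorem not_lineThrough_subset_curve {F : MvPolynomial (Fin 3) ℂ} (hF : F.IsHomogeneous 4)
    (hirr : Irreducible F) {a b : Fin 3 → ℂ} (hab : LinearIndependent ℂ ![a, b]) :
    ¬ lineThrough a b ⊆ curve F := by
  refine fun h => not_vanish_on_line hF hirr hab fun s t => ?_
  by_cases h0 : s • a + t • b = 0
  · rw [h0, eval_zero_of_quartic hF]
  · exact (mk_mem_curve hF h0).1 (h ⟨s, t, h0, rfl⟩)

theorem two_le_multAt_iff {F : MvPolynomial (Fin 3) ℂ} (hF : F.IsHomogeneous 4)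
    (hirr : Irreducible F) {a b : Fin 3 → ℂ} (hab : LinearIndependent ℂ ![a, b]) :
    2 ≤ multAt F a b ↔ (lineRest F a b).coeff 0 = 0 ∧ (lineRest F a b).coeff 1 = 0 := by
  rw [multAt, Polynomial.le_rootMultiplicity_iff (lineRest_ne_zero hF hirr hab), map_zero,
    sub_zero, Polynomial.X_pow_dvd_iff]
  constructor
  · exact fun h => ⟨h 0 two_pos, h 1 one_lt_two⟩
  · rintro ⟨h0, h1⟩ d hd
    interval_cases d <;> assumption

/-- Away from components of the curve, being everywhere tangent means that the quartic
restricts to the square of a binary quadratic form. -/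
theorem everywhereTangent_lineThrough_iff {F : MvPolynomial (Fin 3) ℂ} (hF : F.IsHomogeneous 4)
    (hirr : Irreducible F) {a b : Fin 3 → ℂ} (hab : LinearIndependent ℂ ![a, b]) :
    EverywhereTangent F (lineThrough a b) ↔ ∃ g₀ g₁ g₂ : ℂ, ∀ s t : ℂ,
      eval (s • a + t • b) F = (g₀ * s ^ 2 + g₁ * s * t + g₂ * t ^ 2) ^ 2 := by
  constructor
  · intro h
    obtain ⟨c₀, c₁, c₂, c₃, c₄, hc⟩ := exists_binary_expansion hF a b
    simp only [hc]
    refine exists_quadratic_sq_eq (fun r hr => ?_) fun h4 => ?_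
    · have hli : LinearIndependent ℂ ![a + r • b, b] :=
        (LinearIndependent.pair_add_smul_left_iff ..).2 hab
      have hne : a + r • b ≠ 0 := hli.ne_zero 0
      have hev : ∀ t : ℂ, eval (a + r • b + t • b) F =
          c₀ + c₁ * (r + t) + c₂ * (r + t) ^ 2 + c₃ * (r + t) ^ 3 + c₄ * (r + t) ^ 4 := by
        intro t
        have := hc 1 (r + t)
        rw [one_smul, add_smul, ← add_assoc] at this
        rw [this]
        ring
      have h2 := h _ _ hli (lineThrough_add_smul a b r).symm hne
        ((mk_mem_curve hF hne).2 (by simpa [hr] using hev 0))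
      rw [two_le_multAt_iff hF hirr hli] at h2
      have h1 := (lineRest_coeff (F := F) (a := a + r • b) (b := b)
        (k₀ := c₀ + c₁ * r + c₂ * r ^ 2 + c₃ * r ^ 3 + c₄ * r ^ 4)
        (k₁ := c₁ + 2 * c₂ * r + 3 * c₃ * r ^ 2 + 4 * c₄ * r ^ 3)
        (k₂ := c₂ + 3 * c₃ * r + 6 * c₄ * r ^ 2) (k₃ := c₃ + 4 * c₄ * r) (k₄ := c₄)
        fun t => by rw [hev]; ring).2.1
      rw [← h1, h2.2]
    · have hli : LinearIndependent ℂ ![b, a] := LinearIndependent.pair_symm_iff.1 hab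
      have hne : b ≠ 0 := hli.ne_zero 0
      have hev : ∀ t : ℂ, eval (b + t • a) F =
          c₄ + c₃ * t + c₂ * t ^ 2 + c₁ * t ^ 3 + c₀ * t ^ 4 := by
        intro t
        have := hc t 1
        rw [one_smul, add_comm] at this
        rw [this]
        ring
      have h2 := h _ _ hli (lineThrough_comm a b) hne
        ((mk_mem_curve hF hne).2 (by simpa [h4] using hev 0))
      rw [two_le_multAt_iff hF hirr hli] at h2
      rw [← (lineRest_coeff hev).2.1, h2.2]
  · rintro ⟨g₀, g₁, g₂, hg⟩ a' b' hab' hS ha' hcurve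
    have ha := ha'
    have hmem : ∀ v, v ≠ 0 → (∃ s t : ℂ, v = s • a' + t • b') → ∃ s t : ℂ, v = s • a + t • b := by
      intro v hv hv'
      rwa [← mk_mem_lineThrough hv, hS, mk_mem_lineThrough]
    obtain ⟨s₁, t₁, h₁⟩ := hmem a' ha' ⟨1, 0, by simp⟩
    obtain ⟨s₂, t₂, h₂⟩ := hmem b' (hab'.ne_zero 1) ⟨0, 1, by simp⟩
    have hev : ∀ t : ℂ, eval (a' + t • b') F = (g₀ * (s₁ + t * s₂) ^ 2 +
        g₁ * (s₁ + t * s₂) * (t₁ + t * t₂) + g₂ * (t₁ + t * t₂) ^ 2) ^ 2 := by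
      intro t
      rw [← hg, show a' + t • b' = (s₁ + t * s₂) • a + (t₁ + t * t₂) • b by rw [h₁, h₂]; module]
    have h0 : g₀ * s₁ ^ 2 + g₁ * s₁ * t₁ + g₂ * t₁ ^ 2 = 0 := by
      have := (mk_mem_curve hF ha').1 hcurve
      rw [h₁, hg] at this
      exact pow_eq_zero_iff two_ne_zero |>.1 this
    rw [two_le_multAt_iff hF hirr hab']
    have := lineRest_coeff (F := F) (a := a') (b := b') (k₀ := 0) (k₁ := 0)
      (k₂ := (2 * g₀ * s₁ * s₂ + g₁ * (s₁ * t₂ + s₂ * t₁) + 2 * g₂ * t₁ * t₂) ^ 2)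
      (k₃ := 2 * (2 * g₀ * s₁ * s₂ + g₁ * (s₁ * t₂ + s₂ * t₁) + 2 * g₂ * t₁ * t₂) *
        (g₀ * s₂ ^ 2 + g₁ * s₂ * t₂ + g₂ * t₂ ^ 2))
      (k₄ := (g₀ * s₂ ^ 2 + g₁ * s₂ * t₂ + g₂ * t₂ ^ 2) ^ 2) fun t => by
        rw [hev]
        linear_combination ((g₀ * s₁ ^ 2 + g₁ * s₁ * t₁ + g₂ * t₁ ^ 2) +
          2 * t * (2 * g₀ * s₁ * s₂ + g₁ * (s₁ * t₂ + s₂ * t₁) + 2 * g₂ * t₁ * t₂) +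
          2 * t ^ 2 * (g₀ * s₂ ^ 2 + g₁ * s₂ * t₂ + g₂ * t₂ ^ 2)) * h0
    exact ⟨this.1, this.2.1⟩

/-- The line with equation `ℓ` in the coordinates given by `T`. -/
def dualLine (T : (Fin 3 → ℂ) ≃ₗ[ℂ] (Fin 3 → ℂ)) (ℓ : Fin 3 → ℂ) : Set P2 :=
  {p | ℓ ⬝ᵥ T.symm p.rep = 0}

theorem mk_mem_dualLine {T : (Fin 3 → ℂ) ≃ₗ[ℂ] (Fin 3 → ℂ)} {ℓ u : Fin 3 → ℂ} (h : T u ≠ 0) :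
    Projectivization.mk ℂ (T u) h ∈ dualLine T ℓ ↔ ℓ ⬝ᵥ u = 0 := by
  obtain ⟨r, hr⟩ := Projectivization.exists_smul_eq_mk_rep ℂ (T u) h
  rw [dualLine, Set.mem_ofPred_eq, ← hr]
  simp [Units.smul_def]

theorem dualLine_smul (T : (Fin 3 → ℂ) ≃ₗ[ℂ] (Fin 3 → ℂ)) {r : ℂ} (hr : r ≠ 0)
    (ℓ : Fin 3 → ℂ) : dualLine T (r • ℓ) = dualLine T ℓ := by
  ext p
  simp [dualLine, hr]

theorem minors_eq_of_dualLine_eq {T : (Fin 3 → ℂ) ≃ₗ[ℂ] (Fin 3 → ℂ)} {ℓ m : Fin 3 → ℂ}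
    (h : dualLine T ℓ = dualLine T m) (i j : Fin 3) : ℓ i * m j = ℓ j * m i := by
  by_cases hu : (Pi.single i (ℓ j) - Pi.single j (ℓ i) : Fin 3 → ℂ) = 0
  · by_cases hij : i = j
    · rw [hij]
    · have h1 := congrFun hu i
      have h2 := congrFun hu j
      simp [hij, Ne.symm hij] at h1 h2
      simp [h1, h2]
  · have hT := (map_ne_zero_iff T T.injective).2 hu
    have := (mk_mem_dualLine (ℓ := ℓ) hT).2 (by simp [dotProduct_sub, mul_comm])
    rw [h, mk_mem_dualLine] at this
    simp [dotProduct_sub] at this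
    linear_combination -this

theorem dualLine_eq_lineThrough (T : (Fin 3 → ℂ) ≃ₗ[ℂ] (Fin 3 → ℂ)) {ℓ u v : Fin 3 → ℂ}
    (hℓ : ℓ ≠ 0) (huv : LinearIndependent ℂ ![u, v]) (hu : ℓ ⬝ᵥ u = 0) (hv : ℓ ⬝ᵥ v = 0) :
    dualLine T ℓ = lineThrough (T u) (T v) := by
  ext p
  induction p using Projectivization.ind with | h x hx =>
  obtain ⟨y, rfl⟩ := T.surjective x
  rw [mk_mem_dualLine, mk_mem_lineThrough]
  constructor
  · intro hy
    have hmem : y ∈ Submodule.span ℂ (Set.range ![u, v]) := by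
      by_contra hmem
      obtain ⟨S, hS⟩ := exists_linearEquiv_of_linearIndependent (huv.finCons hmem)
      refine hℓ (dotProduct_eq_zero_iff.1 fun z => ?_)
      have := hS (S.symm z)
      rw [S.apply_symm_apply] at this
      rw [this]
      simp [dotProduct_add, hu, hv, hy]
    rw [Matrix.range_cons, Matrix.range_cons, Matrix.range_empty, Set.union_empty,
      Set.singleton_union, Submodule.mem_span_pair] at hmem
    obtain ⟨s, t, rfl⟩ := hmem
    exact ⟨s, t, by simp⟩
  · rintro ⟨s, t, h⟩
    have : y = s • u + t • v := T.injective (by simp [h])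
    simp [this, dotProduct_add, hu, hv]

theorem IsLine.exists_dualLine (T : (Fin 3 → ℂ) ≃ₗ[ℂ] (Fin 3 → ℂ)) {S : Set P2} (hS : IsLine S) :
    ∃ ℓ : Fin 3 → ℂ, ℓ ≠ 0 ∧ S = dualLine T ℓ := by
  obtain ⟨a, b, hab, rfl⟩ := hS
  obtain ⟨u, rfl⟩ := T.surjective a
  obtain ⟨v, rfl⟩ := T.surjective b
  have huv : LinearIndependent ℂ ![u, v] := by
    rw [LinearIndependent.pair_iff] at hab ⊢
    intro s t h
    exact hab s t (by rw [← map_smul, ← map_smul, ← map_add, h, map_zero])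
  refine ⟨crossProduct u v, crossProduct_ne_zero_iff_linearIndependent.2 huv, ?_⟩
  refine (dualLine_eq_lineThrough T (crossProduct_ne_zero_iff_linearIndependent.2 huv) huv
    ?_ ?_).symm
  · rw [dotProduct_comm, dot_self_cross]
  · rw [dotProduct_comm, dot_cross_self]

theorem linearIndependent_map_pair (T : (Fin 3 → ℂ) ≃ₗ[ℂ] (Fin 3 → ℂ)) {u v : Fin 3 → ℂ}
    (h : LinearIndependent ℂ ![u, v]) : LinearIndependent ℂ ![T u, T v] := by
  rw [LinearIndependent.pair_iff] at h ⊢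
  exact fun s t he => h s t (T.injective (by simpa using he))

/-! ### Coordinates adapted to the nodes -/

theorem linearIndependent_pair_of_mk_ne {x y : Fin 3 → ℂ} {hx : x ≠ 0} {hy : y ≠ 0}
    (h : Projectivization.mk ℂ x hx ≠ Projectivization.mk ℂ y hy) :
    LinearIndependent ℂ ![x, y] :=
  (LinearIndependent.pair_iff' hx).2 fun r hr =>
    h ((Projectivization.mk_eq_mk_iff' ℂ _ _ hy hx).2 ⟨r, hr⟩).symm

theorem linearIndependent_of_nodes {F : MvPolynomial (Fin 3) ℂ} (hF : F.IsHomogeneous 4)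
    (hirr : Irreducible F) {w₁ w₂ w₃ : Fin 3 → ℂ} {h₁ : w₁ ≠ 0} {h₂ : w₂ ≠ 0} {h₃ : w₃ ≠ 0}
    (h12 : Projectivization.mk ℂ w₁ h₁ ≠ Projectivization.mk ℂ w₂ h₂)
    (h13 : Projectivization.mk ℂ w₁ h₁ ≠ Projectivization.mk ℂ w₃ h₃)
    (h23 : Projectivization.mk ℂ w₂ h₂ ≠ Projectivization.mk ℂ w₃ h₃)
    (hw₁ : eval w₁ F = 0) (hs₂ : IsSingularAt F (Projectivization.mk ℂ w₂ h₂))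
    (hs₃ : IsSingularAt F (Projectivization.mk ℂ w₃ h₃)) :
    LinearIndependent ℂ ![w₁, w₂, w₃] := by
  have hli : LinearIndependent ℂ ![w₂, w₃] := linearIndependent_pair_of_mk_ne h23
  refine hli.finCons fun hmem => ?_
  rw [Matrix.range_cons, Matrix.range_cons, Matrix.range_empty, Set.union_empty,
    Set.singleton_union, Submodule.mem_span_pair] at hmem
  obtain ⟨s, t, rfl⟩ := hmem
  have hs : s ≠ 0 := by
    rintro rfl
    exact h13 ((Projectivization.mk_eq_mk_iff' ℂ _ _ h₁ h₃).2 ⟨t, by simp⟩)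
  have ht : t ≠ 0 := by
    rintro rfl
    exact h12 ((Projectivization.mk_eq_mk_iff' ℂ _ _ h₁ h₂).2 ⟨s, by simp⟩)
  obtain ⟨c₀, c₁, c₂, c₃, c₄, hc⟩ := exists_binary_expansion hF w₂ w₃
  obtain ⟨e0, e1, -⟩ := lineRest_coeff (F := F) (a := w₂) (b := w₃)
    (k₀ := c₀) (k₁ := c₁) (k₂ := c₂) (k₃ := c₃) (k₄ := c₄) fun r => by
      have := hc 1 r
      rw [one_smul] at this
      rw [this]
      ring
  obtain ⟨e4, e3, -⟩ := lineRest_coeff (F := F) (a := w₃) (b := w₂)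
    (k₀ := c₄) (k₁ := c₃) (k₂ := c₂) (k₃ := c₁) (k₄ := c₀) fun r => by
      have := hc r 1
      rw [one_smul, add_comm] at this
      rw [this]
      ring
  rw [(hs₂.lineRest_coeff w₃).1] at e0
  rw [(hs₂.lineRest_coeff w₃).2] at e1
  rw [(hs₃.lineRest_coeff w₂).1] at e4
  rw [(hs₃.lineRest_coeff w₂).2] at e3
  rw [hc, ← e0, ← e1, ← e3, ← e4] at hw₁
  have e2 : c₂ = 0 := by simpa [hs, ht] using hw₁
  refine not_vanish_on_line hF hirr hli fun x y => ?_
  rw [hc, ← e0, ← e1, e2, ← e3, ← e4]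
  ring

theorem OrdinaryNode.sq_ne {F : MvPolynomial (Fin 3) ℂ} {w₁ w₂ w₃ : Fin 3 → ℂ}
    (hspan : ∀ v : Fin 3 → ℂ, ∃ x y z : ℂ, v = x • w₁ + y • w₂ + z • w₃)
    {A B C a b c : ℂ} (hf : ∀ x y z : ℂ, eval (x • w₁ + y • w₂ + z • w₃) F =
      A * y ^ 2 * z ^ 2 + B * x ^ 2 * z ^ 2 + C * x ^ 2 * y ^ 2 +
        2 * x * y * z * (a * x + b * y + c * z))
    (hB : B ≠ 0) {hw : w₁ ≠ 0} (h : OrdinaryNode F (Projectivization.mk ℂ w₁ hw)) :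
    a ^ 2 ≠ B * C := by
  intro hsq
  obtain ⟨b₁, b₂, hli, hb₁, hb₂⟩ := h.2 w₁ hw rfl
  have hcone : ∀ x y z : ℂ, coneCoeff F w₁ (x • w₁ + y • w₂ + z • w₃) = 0 → B * z + a * y = 0 := by
    intro x y z h0
    have := (lineRest_coeff (F := F) (a := w₁) (b := x • w₁ + y • w₂ + z • w₃)
      (k₀ := 0) (k₁ := 0) (k₂ := B * z ^ 2 + C * y ^ 2 + 2 * a * y * z)
      (k₃ := 2 * x * (B * z ^ 2 + C * y ^ 2 + 2 * a * y * z) + 2 * y * z * (b * y + c * z))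
      (k₄ := A * y ^ 2 * z ^ 2 + x ^ 2 * (B * z ^ 2 + C * y ^ 2 + 2 * a * y * z) +
        2 * x * y * z * (b * y + c * z)) fun t => by
          rw [show w₁ + t • (x • w₁ + y • w₂ + z • w₃) =
            (1 + t * x) • w₁ + (t * y) • w₂ + (t * z) • w₃ by module, hf]
          ring).2.2.1
    rw [coneCoeff, this] at h0
    refine pow_eq_zero_iff two_ne_zero |>.1 ?_
    linear_combination B * h0 + y ^ 2 * hsq
  obtain ⟨x₁, y₁, z₁, rfl⟩ := hspan b₁
  obtain ⟨x₂, y₂, z₂, rfl⟩ := hspan b₂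
  have e₁ := hcone _ _ _ hb₁
  have e₂ := hcone _ _ _ hb₂
  have hdet : y₁ * z₂ = y₂ * z₁ := by
    refine mul_left_cancel₀ hB ?_
    linear_combination y₁ * e₂ - y₂ * e₁
  rw [Fintype.linearIndependent_iff] at hli
  have hz := hli ![z₁ * x₂ - z₂ * x₁, z₂, -z₁] (by
    simp only [Fin.sum_univ_three, Matrix.cons_val]
    ext i
    simp only [Pi.add_apply, Pi.smul_apply, smul_eq_mul, Pi.zero_apply]
    linear_combination w₂ i * hdet)
  have hy := hli ![y₁ * x₂ - y₂ * x₁, y₂, -y₁] (by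
    simp only [Fin.sum_univ_three, Matrix.cons_val]
    ext i
    simp only [Pi.add_apply, Pi.smul_apply, smul_eq_mul, Pi.zero_apply]
    linear_combination -w₃ i * hdet)
  have hz1 := hz 2
  have hy1 := hy 2
  simp only [Matrix.cons_val, neg_eq_zero] at hz1 hy1
  have := hli ![-x₁, 1, 0] (by
    simp [Fin.sum_univ_three, hz1, hy1]) 1
  simp at this

/-- Coordinates on the plane in which the three nodes are the coordinate points. -/
structure TrinodalFrame (F : MvPolynomial (Fin 3) ℂ) (p₁ p₂ p₃ : P2) where
  T : (Fin 3 → ℂ) ≃ₗ[ℂ] (Fin 3 → ℂ)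
  (A B C a b c : ℂ)
  eval_eq : ∀ x y z : ℂ, eval (T ![x, y, z]) F =
    A * y ^ 2 * z ^ 2 + B * x ^ 2 * z ^ 2 + C * x ^ 2 * y ^ 2 +
      2 * x * y * z * (a * x + b * y + c * z)
  A_ne : A ≠ 0
  B_ne : B ≠ 0
  C_ne : C ≠ 0
  a_sq_ne : a ^ 2 ≠ B * C
  b_sq_ne : b ^ 2 ≠ A * C
  c_sq_ne : c ^ 2 ≠ A * B
  det_ne : A * B * C + 2 * a * b * c - A * a ^ 2 - B * b ^ 2 - C * c ^ 2 ≠ 0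
  mem₁ : ∀ ℓ, p₁ ∈ dualLine T ℓ ↔ ℓ 0 = 0
  mem₂ : ∀ ℓ, p₂ ∈ dualLine T ℓ ↔ ℓ 1 = 0
  mem₃ : ∀ ℓ, p₃ ∈ dualLine T ℓ ↔ ℓ 2 = 0

theorem det_ne_zero_of_irreducible {F : MvPolynomial (Fin 3) ℂ} (hirr : Irreducible F)
    (T : (Fin 3 → ℂ) ≃ₗ[ℂ] (Fin 3 → ℂ)) {A B C a b c : ℂ}
    (h : ∀ u, eval (T u) F =
      A * u 1 ^ 2 * u 2 ^ 2 + B * u 0 ^ 2 * u 2 ^ 2 + C * u 0 ^ 2 * u 1 ^ 2 +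
        2 * u 0 * u 1 * u 2 * (a * u 0 + b * u 1 + c * u 2))
    (hA : A ≠ 0) (hc : c ^ 2 ≠ A * B) :
    A * B * C + 2 * a * b * c - A * a ^ 2 - B * b ^ 2 - C * c ^ 2 ≠ 0 := by
  intro hdet
  obtain ⟨κ, hκ⟩ := exists_sq (c ^ 2 - A * B)
  have hκ0 : κ ≠ 0 := by
    rintro rfl
    exact hc (by linear_combination -hκ)
  obtain ⟨m, hm⟩ : ∃ m, κ * m = b * c - a * A := ⟨(b * c - a * A) / κ, by field_simp⟩
  have hm2 : m ^ 2 = b ^ 2 - A * C := by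
    refine mul_left_cancel₀ (pow_ne_zero 2 hκ0) ?_
    linear_combination (κ * m + b * c - a * A) * hm - (b ^ 2 - A * C) * hκ - A * hdet
  refine false_of_factorization hirr T
    (H₁ := MvPolynomial.C A⁻¹ * (MvPolynomial.C A * X 1 * X 2 +
      MvPolynomial.C (c + κ) * X 0 * X 2 + MvPolynomial.C (b + m) * X 0 * X 1))
    (H₂ := MvPolynomial.C A * X 1 * X 2 + MvPolynomial.C (c - κ) * X 0 * X 2 +
      MvPolynomial.C (b - m) * X 0 * X 1) (by simp) (by simp) fun u => ?_
  rw [h]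
  simp only [map_add, map_mul, eval_C, eval_X]
  field_simp
  linear_combination u 0 ^ 2 * u 2 ^ 2 * hκ + 2 * u 0 ^ 2 * u 1 * u 2 * hm +
    u 0 ^ 2 * u 1 ^ 2 * hm2

theorem nonempty_trinodalFrame {F : MvPolynomial (Fin 3) ℂ} (hF : F.IsHomogeneous 4)
    (hirr : Irreducible F) {p₁ p₂ p₃ : P2} (h12 : p₁ ≠ p₂) (h13 : p₁ ≠ p₃) (h23 : p₂ ≠ p₃)
    (h₁ : OrdinaryNode F p₁) (h₂ : OrdinaryNode F p₂) (h₃ : OrdinaryNode F p₃) :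
    Nonempty (TrinodalFrame F p₁ p₂ p₃) := by
  induction p₁ using Projectivization.ind with | h w₁ hw₁ =>
  induction p₂ using Projectivization.ind with | h w₂ hw₂ =>
  induction p₃ using Projectivization.ind with | h w₃ hw₃ =>
  have s₁ : IsSingularAt F _ := h₁.1.1
  have s₂ : IsSingularAt F _ := h₂.1.1
  have s₃ : IsSingularAt F _ := h₃.1.1
  have hF₁ := (s₁.lineRest_coeff 0).1
  rw [lineRest_coeff_zero] at hF₁
  have hli := linearIndependent_of_nodes hF hirr h12 h13 h23 hF₁ s₂ s₃
  obtain ⟨T, hT⟩ := exists_linearEquiv_of_linearIndependent hli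
  obtain ⟨k, hk⟩ := exists_quartic_expansion hF w₁ w₂ w₃
  have e12 := lineRest_coeff (F := F) (a := w₁) (b := w₂) (k₀ := k 4 0 0) (k₁ := k 3 1 0)
    (k₂ := k 2 2 0) (k₃ := k 1 3 0) (k₄ := k 0 4 0) fun t => by
      rw [show w₁ + t • w₂ = (1 : ℂ) • w₁ + t • w₂ + (0 : ℂ) • w₃ by module, hk]; ring
  have e13 := lineRest_coeff (F := F) (a := w₁) (b := w₃) (k₀ := k 4 0 0) (k₁ := k 3 0 1)
    (k₂ := k 2 0 2) (k₃ := k 1 0 3) (k₄ := k 0 0 4) fun t => by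
      rw [show w₁ + t • w₃ = (1 : ℂ) • w₁ + (0 : ℂ) • w₂ + t • w₃ by module, hk]; ring
  have e21 := lineRest_coeff (F := F) (a := w₂) (b := w₁) (k₀ := k 0 4 0) (k₁ := k 1 3 0)
    (k₂ := k 2 2 0) (k₃ := k 3 1 0) (k₄ := k 4 0 0) fun t => by
      rw [show w₂ + t • w₁ = t • w₁ + (1 : ℂ) • w₂ + (0 : ℂ) • w₃ by module, hk]; ring
  have e23 := lineRest_coeff (F := F) (a := w₂) (b := w₃) (k₀ := k 0 4 0) (k₁ := k 0 3 1)
    (k₂ := k 0 2 2) (k₃ := k 0 1 3) (k₄ := k 0 0 4) fun t => by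
      rw [show w₂ + t • w₃ = (0 : ℂ) • w₁ + (1 : ℂ) • w₂ + t • w₃ by module, hk]; ring
  have e31 := lineRest_coeff (F := F) (a := w₃) (b := w₁) (k₀ := k 0 0 4) (k₁ := k 1 0 3)
    (k₂ := k 2 0 2) (k₃ := k 3 0 1) (k₄ := k 4 0 0) fun t => by
      rw [show w₃ + t • w₁ = t • w₁ + (0 : ℂ) • w₂ + (1 : ℂ) • w₃ by module, hk]; ring
  have e32 := lineRest_coeff (F := F) (a := w₃) (b := w₂) (k₀ := k 0 0 4) (k₁ := k 0 1 3)
    (k₂ := k 0 2 2) (k₃ := k 0 3 1) (k₄ := k 0 4 0) fun t => by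
      rw [show w₃ + t • w₂ = (0 : ℂ) • w₁ + t • w₂ + (1 : ℂ) • w₃ by module, hk]; ring
  have hf : ∀ x y z : ℂ, eval (x • w₁ + y • w₂ + z • w₃) F =
      k 0 2 2 * y ^ 2 * z ^ 2 + k 2 0 2 * x ^ 2 * z ^ 2 + k 2 2 0 * x ^ 2 * y ^ 2 +
        2 * x * y * z * (k 2 1 1 / 2 * x + k 1 2 1 / 2 * y + k 1 1 2 / 2 * z) := by
    intro x y z
    rw [hk, ← e12.1, ← e12.2.1, ← e13.2.1, ← e21.1, ← e21.2.1, ← e23.2.1, ← e31.1, ← e31.2.1,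
      ← e32.2.1, (s₁.lineRest_coeff w₂).1, (s₁.lineRest_coeff w₂).2, (s₁.lineRest_coeff w₃).2,
      (s₂.lineRest_coeff w₁).1, (s₂.lineRest_coeff w₁).2, (s₂.lineRest_coeff w₃).2,
      (s₃.lineRest_coeff w₁).1, (s₃.lineRest_coeff w₁).2, (s₃.lineRest_coeff w₂).2]
    ring
  have hspan : ∀ v : Fin 3 → ℂ, ∃ x y z : ℂ, v = x • w₁ + y • w₂ + z • w₃ := fun v =>
    ⟨_, _, _, by rw [← hT, T.apply_symm_apply]⟩
  generalize k 0 2 2 = A, k 2 0 2 = B, k 2 2 0 = C, k 2 1 1 / 2 = a, k 1 2 1 / 2 = b,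
    k 1 1 2 / 2 = c at hf
  have hA : A ≠ 0 := by
    rintro rfl
    refine not_vanish_on_line hF hirr (linearIndependent_pair_of_mk_ne h23) fun s t => ?_
    rw [show s • w₂ + t • w₃ = (0 : ℂ) • w₁ + s • w₂ + t • w₃ by module, hf]
    ring
  have hB : B ≠ 0 := by
    rintro rfl
    refine not_vanish_on_line hF hirr (linearIndependent_pair_of_mk_ne h13) fun s t => ?_
    rw [show s • w₁ + t • w₃ = s • w₁ + (0 : ℂ) • w₂ + t • w₃ by module, hf]
    ring
  have hC : C ≠ 0 := by
    rintro rfl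
    refine not_vanish_on_line hF hirr (linearIndependent_pair_of_mk_ne h12) fun s t => ?_
    rw [show s • w₁ + t • w₂ = s • w₁ + t • w₂ + (0 : ℂ) • w₃ by module, hf]
    ring
  have hc : c ^ 2 ≠ A * B := by
    refine OrdinaryNode.sq_ne (w₁ := w₃) (w₂ := w₁) (w₃ := w₂) (A := C) (b := a) (c := b)
      (fun v => ?_) (fun x y z => ?_) hA h₃
    · obtain ⟨x, y, z, rfl⟩ := hspan v
      exact ⟨z, x, y, by module⟩
    · rw [show x • w₃ + y • w₁ + z • w₂ = y • w₁ + z • w₂ + x • w₃ by module, hf]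
      ring
  have hmem : ∀ {u w : Fin 3 → ℂ} (hw : w ≠ 0), T u = w → ∀ ℓ,
      Projectivization.mk ℂ w hw ∈ dualLine T ℓ ↔ ℓ ⬝ᵥ u = 0 := by
    rintro u _ hw rfl ℓ
    exact mk_mem_dualLine hw
  refine ⟨{
    T := T, A := A, B := B, C := C, a := a, b := b, c := c
    eval_eq := fun x y z => by simpa [hT] using hf x y z
    A_ne := hA, B_ne := hB, C_ne := hC
    a_sq_ne := OrdinaryNode.sq_ne hspan hf hB h₁
    b_sq_ne := ?_
    c_sq_ne := hc
    det_ne := det_ne_zero_of_irreducible hirr T (fun u => by rw [hT, hf]) hA hc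
    mem₁ := fun ℓ => (hmem (u := ![1, 0, 0]) hw₁ (by simp [hT]) ℓ).trans (by
      simp [dotProduct, Fin.sum_univ_three])
    mem₂ := fun ℓ => (hmem (u := ![0, 1, 0]) hw₂ (by simp [hT]) ℓ).trans (by
      simp [dotProduct, Fin.sum_univ_three])
    mem₃ := fun ℓ => (hmem (u := ![0, 0, 1]) hw₃ (by simp [hT]) ℓ).trans (by
      simp [dotProduct, Fin.sum_univ_three]) }⟩
  refine OrdinaryNode.sq_ne (w₁ := w₂) (w₂ := w₁) (w₃ := w₃) (A := B) (b := a) (c := c)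
    (fun v => ?_) (fun x y z => ?_) hA h₂
  · obtain ⟨x, y, z, rfl⟩ := hspan v
    exact ⟨y, x, z, by module⟩
  · rw [show x • w₂ + y • w₁ + z • w₃ = y • w₁ + x • w₂ + z • w₃ by module, hf]
    ring

/-! ### Counting theta-lines -/

section Counting

variable {F : MvPolynomial (Fin 3) ℂ} {p₁ p₂ p₃ : P2}

open Classical in
theorem ncard_singular_eq (h12 : p₁ ≠ p₂) (h13 : p₁ ≠ p₃) (h23 : p₂ ≠ p₃)
    (hsing : ∀ q, IsSingularAt F q ↔ q = p₁ ∨ q = p₂ ∨ q = p₃) (S : Set P2) :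
    {p | p ∈ S ∧ IsSingularAt F p}.ncard =
      (if p₁ ∈ S then 1 else 0) + (if p₂ ∈ S then 1 else 0) + (if p₃ ∈ S then 1 else 0) := by
  have : {p | p ∈ S ∧ IsSingularAt F p} =
      ((({p₁, p₂, p₃} : Finset P2).filter (· ∈ S) : Finset P2) : Set P2) := by
    ext q
    simp [hsing, and_comm]
  rw [this, Set.ncard_coe_finset, Finset.card_filter, Finset.sum_insert (by simp [h12, h13]),
    Finset.sum_insert (by simp [h23]), Finset.sum_singleton, add_assoc]

namespace TrinodalFrame

theorem thetaLineOfType_iff (fr : TrinodalFrame F p₁ p₂ p₃) (hF : F.IsHomogeneous 4)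
    (hirr : Irreducible F)
    {ℓ u v : Fin 3 → ℂ} (hℓ : ℓ ≠ 0) (huv : LinearIndependent ℂ ![u, v]) (hu : ℓ ⬝ᵥ u = 0)
    (hv : ℓ ⬝ᵥ v = 0) (i : ℕ) :
    ThetaLineOfType F i (dualLine fr.T ℓ) ↔
      (∃ g₀ g₁ g₂ : ℂ, ∀ s t : ℂ,
        eval (fr.T (s • u + t • v)) F = (g₀ * s ^ 2 + g₁ * s * t + g₂ * t ^ 2) ^ 2) ∧
      {p | p ∈ dualLine fr.T ℓ ∧ IsSingularAt F p}.ncard = i := by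
  have hli := linearIndependent_map_pair fr.T huv
  have hnot := not_lineThrough_subset_curve hF hirr hli
  have htan := everywhereTangent_lineThrough_iff hF hirr hli
  rw [← dualLine_eq_lineThrough fr.T hℓ huv hu hv] at hnot htan
  have hline : IsLine (dualLine fr.T ℓ) := ⟨_, _, hli, dualLine_eq_lineThrough fr.T hℓ huv hu hv⟩
  simp only [ThetaLineOfType, ThetaLine, hline, hnot, htan, map_add, map_smul, true_and, false_or,
    not_false_eq_true]

theorem exists_eq_dualLine (fr : TrinodalFrame F p₁ p₂ p₃) {i : ℕ} {S : Set P2}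
    (h : ThetaLineOfType F i S) :
    ∃ ℓ, ℓ ≠ 0 ∧ S = dualLine fr.T ℓ :=
  h.1.1.exists_dualLine fr.T

/-! #### Lines through two nodes -/

theorem thetaLineOfType_two_iff (fr : TrinodalFrame F p₁ p₂ p₃) (hF : F.IsHomogeneous 4)
    (hirr : Irreducible F)
    (h12 : p₁ ≠ p₂) (h13 : p₁ ≠ p₃) (h23 : p₂ ≠ p₃)
    (hsing : ∀ q, IsSingularAt F q ↔ q = p₁ ∨ q = p₂ ∨ q = p₃) (S : Set P2) :
    ThetaLineOfType F 2 S ↔ S = dualLine fr.T ![1, 0, 0] ∨ S = dualLine fr.T ![0, 1, 0] ∨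
      S = dualLine fr.T ![0, 0, 1] := by
  constructor
  · intro h
    obtain ⟨ℓ, hℓ, rfl⟩ := fr.exists_eq_dualLine h
    have hcard := h.2.2
    rw [ncard_singular_eq h12 h13 h23 hsing, fr.mem₁, fr.mem₂, fr.mem₃] at hcard
    have key : ∀ e : Fin 3 → ℂ, (∃ r : ℂ, r ≠ 0 ∧ ℓ = r • e) →
        dualLine fr.T ℓ = dualLine fr.T e := by
      rintro e ⟨r, hr, rfl⟩
      exact dualLine_smul _ hr e
    split_ifs at hcard with h0 h1 h2 h2 h1 h2 h2 <;> norm_num at hcard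
    · refine .inr (.inr (key _ ⟨ℓ 2, h2, ?_⟩))
      ext i; fin_cases i <;> simp [h0, h1]
    · refine .inr (.inl (key _ ⟨ℓ 1, h1, ?_⟩))
      ext i; fin_cases i <;> simp [h0, h2]
    · refine .inl (key _ ⟨ℓ 0, h0, ?_⟩)
      ext i; fin_cases i <;> simp [h1, h2]
  · rintro (rfl | rfl | rfl)
    · obtain ⟨k, hk⟩ := exists_sq fr.A
      rw [fr.thetaLineOfType_iff hF hirr (u := ![0, 1, 0]) (v := ![0, 0, 1]) (by simp)
        (by rw [LinearIndependent.pair_iff]; intro s t h; simpa using h) (by simp) (by simp),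
        ncard_singular_eq h12 h13 h23 hsing, fr.mem₁, fr.mem₂, fr.mem₃]
      refine ⟨⟨0, k, 0, fun s t => ?_⟩, by simp⟩
      rw [show s • ![0, 1, 0] + t • ![0, 0, 1] = ![0, s, t] by simp, fr.eval_eq]
      linear_combination -s ^ 2 * t ^ 2 * hk
    · obtain ⟨k, hk⟩ := exists_sq fr.B
      rw [fr.thetaLineOfType_iff hF hirr (u := ![1, 0, 0]) (v := ![0, 0, 1]) (by simp)
        (by rw [LinearIndependent.pair_iff]; intro s t h; simpa using h) (by simp) (by simp),
        ncard_singular_eq h12 h13 h23 hsing, fr.mem₁, fr.mem₂, fr.mem₃]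
      refine ⟨⟨0, k, 0, fun s t => ?_⟩, by simp⟩
      rw [show s • ![1, 0, 0] + t • ![0, 0, 1] = ![s, 0, t] by simp, fr.eval_eq]
      linear_combination -s ^ 2 * t ^ 2 * hk
    · obtain ⟨k, hk⟩ := exists_sq fr.C
      rw [fr.thetaLineOfType_iff hF hirr (u := ![1, 0, 0]) (v := ![0, 1, 0]) (by simp)
        (by rw [LinearIndependent.pair_iff]; intro s t h; simpa using h) (by simp) (by simp),
        ncard_singular_eq h12 h13 h23 hsing, fr.mem₁, fr.mem₂, fr.mem₃]
      refine ⟨⟨0, k, 0, fun s t => ?_⟩, by simp⟩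
      rw [show s • ![1, 0, 0] + t • ![0, 1, 0] = ![s, t, 0] by simp, fr.eval_eq]
      linear_combination -s ^ 2 * t ^ 2 * hk

theorem ncard_thetaLineOfType_two (fr : TrinodalFrame F p₁ p₂ p₃) (hF : F.IsHomogeneous 4)
    (hirr : Irreducible F)
    (h12 : p₁ ≠ p₂) (h13 : p₁ ≠ p₃) (h23 : p₂ ≠ p₃)
    (hsing : ∀ q, IsSingularAt F q ↔ q = p₁ ∨ q = p₂ ∨ q = p₃) :
    {S : Set P2 | ThetaLineOfType F 2 S}.ncard = 3 := by
  refine Set.ncard_eq_three.2 ⟨dualLine fr.T ![1, 0, 0], dualLine fr.T ![0, 1, 0],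
    dualLine fr.T ![0, 0, 1], fun h => ?_, fun h => ?_, fun h => ?_, ?_⟩
  · simpa using minors_eq_of_dualLine_eq h 0 1
  · simpa using minors_eq_of_dualLine_eq h 0 2
  · simpa using minors_eq_of_dualLine_eq h 1 2
  · ext S
    simpa using fr.thetaLineOfType_two_iff hF hirr h12 h13 h23 hsing S

/-! #### Lines through one node -/

/-- A theta-line of type 1 through the first node is determined by a root of this quadratic
equation. -/
theorem thetaLineOfType_one_iff (fr : TrinodalFrame F p₁ p₂ p₃) (hF : F.IsHomogeneous 4)
    (hirr : Irreducible F)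
    (h12 : p₁ ≠ p₂) (h13 : p₁ ≠ p₃) (h23 : p₂ ≠ p₃)
    (hsing : ∀ q, IsSingularAt F q ↔ q = p₁ ∨ q = p₂ ∨ q = p₃) {β γ : ℂ}
    (h : ![0, β, γ] ≠ 0) :
    ThetaLineOfType F 1 (dualLine fr.T ![0, β, γ]) ↔ β ≠ 0 ∧ γ ≠ 0 ∧
      (fr.c ^ 2 - fr.A * fr.B) * β ^ 2 + 2 * (fr.a * fr.A - fr.b * fr.c) * (β * γ) +
        (fr.b ^ 2 - fr.A * fr.C) * γ ^ 2 = 0 := by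
  have hli : LinearIndependent ℂ ![![1, 0, 0], ![0, γ, -β]] := by
    rw [LinearIndependent.pair_iff]
    intro s t he
    have e0 := congrFun he 0
    have e1 := congrFun he 1
    have e2 := congrFun he 2
    simp at e0 e1 e2
    refine ⟨e0, by_contra fun ht => h ?_⟩
    simp [e1.resolve_left ht, e2.resolve_left ht]
  rw [fr.thetaLineOfType_iff hF hirr h hli (by simp) (by simp [mul_comm]),
    ncard_singular_eq h12 h13 h23 hsing, fr.mem₁, fr.mem₂, fr.mem₃]
  have hcount : (if (![0, β, γ] : Fin 3 → ℂ) 0 = 0 then 1 else 0) +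
      (if (![0, β, γ] : Fin 3 → ℂ) 1 = 0 then 1 else 0) +
      (if (![0, β, γ] : Fin 3 → ℂ) 2 = 0 then 1 else 0) = 1 ↔ β ≠ 0 ∧ γ ≠ 0 := by
    by_cases hβ : β = 0 <;> by_cases hγ : γ = 0 <;> simp [hβ, hγ]
  rw [hcount, ← and_assoc (a := β ≠ 0), and_comm]
  refine and_congr_right fun hβγ => ?_
  obtain ⟨K, hK⟩ : ∃ K, K = fr.B * β ^ 2 + fr.C * γ ^ 2 - 2 * fr.a * β * γ := ⟨_, rfl⟩
  obtain ⟨M, hM⟩ : ∃ M, M = -γ * β * (fr.b * γ - fr.c * β) := ⟨_, rfl⟩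
  have heval : ∀ s t : ℂ, eval (fr.T (s • ![1, 0, 0] + t • ![0, γ, -β])) F =
      K * s ^ 2 * t ^ 2 + 2 * M * s * t ^ 3 + fr.A * γ ^ 2 * β ^ 2 * t ^ 4 := by
    intro s t
    rw [show s • ![1, 0, 0] + t • ![0, γ, -β] = ![s, t * γ, t * -β] by simp, fr.eval_eq, hK, hM]
    ring
  simp only [heval]
  have hequiv : (∃ g₀ g₁ g₂ : ℂ, ∀ s t : ℂ, K * s ^ 2 * t ^ 2 + 2 * M * s * t ^ 3 +
      fr.A * γ ^ 2 * β ^ 2 * t ^ 4 = (g₀ * s ^ 2 + g₁ * s * t + g₂ * t ^ 2) ^ 2) ↔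
      M ^ 2 = K * (fr.A * γ ^ 2 * β ^ 2) := by
    constructor
    · rintro ⟨g₀, g₁, g₂, hg⟩
      obtain ⟨e0, e1, e2, e3, e4⟩ := quartic_coeff_eq (c₀ := 0) (c₁ := 0) (c₂ := K)
        (c₃ := 2 * M) (c₄ := fr.A * γ ^ 2 * β ^ 2) (d₀ := g₀ ^ 2) (d₁ := 2 * g₀ * g₁)
        (d₂ := g₁ ^ 2 + 2 * g₀ * g₂) (d₃ := 2 * g₁ * g₂) (d₄ := g₂ ^ 2) fun t => by
          linear_combination hg 1 t
      have hg0 : g₀ = 0 := by simpa using e0.symm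
      have e2' : K = g₁ ^ 2 := by rw [e2, hg0]; ring
      have e3' : M = g₁ * g₂ := by linear_combination e3 / 2
      rw [e2', e3', e4]
      ring
    · intro hMK
      have hN : fr.A * γ ^ 2 * β ^ 2 ≠ 0 := by simp [fr.A_ne, hβγ.1, hβγ.2]
      obtain ⟨g, hg⟩ := exists_sq (fr.A * γ ^ 2 * β ^ 2)
      have hg0 : g ≠ 0 := by
        rintro rfl
        exact hN (by linear_combination -hg)
      obtain ⟨m, hm⟩ : ∃ m, m * g = M := ⟨M / g, by field_simp⟩
      have hm2 : m ^ 2 = K := by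
        refine mul_right_cancel₀ hN ?_
        rw [← hMK, ← hg, ← hm]
        ring
      refine ⟨0, m, g, fun s t => ?_⟩
      rw [← hm2, ← hm, ← hg]
      ring
  rw [hequiv, hK, hM]
  have h2 : γ ^ 2 * β ^ 2 ≠ 0 := by simp [hβγ.1, hβγ.2]
  constructor
  · intro he
    refine mul_left_cancel₀ h2 ?_
    linear_combination he
  · intro he
    linear_combination γ ^ 2 * β ^ 2 * he

theorem ncard_thetaLineOfType_one (fr : TrinodalFrame F p₁ p₂ p₃) (hF : F.IsHomogeneous 4)
    (hirr : Irreducible F)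
    (h12 : p₁ ≠ p₂) (h13 : p₁ ≠ p₃) (h23 : p₂ ≠ p₃)
    (hsing : ∀ q, IsSingularAt F q ↔ q = p₁ ∨ q = p₂ ∨ q = p₃) :
    {S : Set P2 | ThetaLineOfType F 1 S ∧ p₁ ∈ S}.ncard = 2 := by
  obtain ⟨k, hk⟩ : ∃ k, k = fr.c ^ 2 - fr.A * fr.B := ⟨_, rfl⟩
  obtain ⟨m, hm⟩ : ∃ m, m = fr.a * fr.A - fr.b * fr.c := ⟨_, rfl⟩
  obtain ⟨n, hn⟩ : ∃ n, n = fr.b ^ 2 - fr.A * fr.C := ⟨_, rfl⟩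
  have hk0 : k ≠ 0 := hk ▸ sub_ne_zero.2 fr.c_sq_ne
  have hn0 : n ≠ 0 := hn ▸ sub_ne_zero.2 fr.b_sq_ne
  obtain ⟨δ, hδ⟩ := exists_sq (m ^ 2 - k * n)
  have hδ0 : δ ≠ 0 := by
    rintro rfl
    refine mul_ne_zero fr.A_ne fr.det_ne ?_
    rw [hk, hm, hn] at hδ
    linear_combination hδ
  have hprod : (-m + δ) * (-m - δ) = k * n := by linear_combination -hδ
  have hplus : -m + δ ≠ 0 := fun h => mul_ne_zero hk0 hn0 (by rw [← hprod, h, zero_mul])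
  have hminus : -m - δ ≠ 0 := fun h => mul_ne_zero hk0 hn0 (by rw [← hprod, h, mul_zero])
  have htheta : ∀ {β γ : ℂ}, ![0, β, γ] ≠ 0 → (ThetaLineOfType F 1 (dualLine fr.T ![0, β, γ]) ↔
      β ≠ 0 ∧ γ ≠ 0 ∧ k * β ^ 2 + 2 * m * (β * γ) + n * γ ^ 2 = 0) := fun h => by
    rw [fr.thetaLineOfType_one_iff hF hirr h12 h13 h23 hsing h, hk, hm, hn]
  have hmem : ∀ β γ : ℂ, p₁ ∈ dualLine fr.T ![0, β, γ] := fun β γ => by rw [fr.mem₁]; rfl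
  refine Set.ncard_eq_two.2 ⟨dualLine fr.T ![0, -m + δ, k], dualLine fr.T ![0, -m - δ, k],
    fun h => ?_, ?_⟩
  · have := minors_eq_of_dualLine_eq h 1 2
    simp only [Matrix.cons_val] at this
    refine mul_ne_zero (mul_ne_zero two_ne_zero hk0) hδ0 ?_
    linear_combination this
  ext S
  simp only [Set.mem_ofPred_eq, Set.mem_insert_iff, Set.mem_singleton_iff]
  constructor
  · rintro ⟨hS, hp⟩
    obtain ⟨ℓ, hℓ, rfl⟩ := fr.exists_eq_dualLine hS
    rw [fr.mem₁] at hp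
    obtain ⟨β, γ, rfl⟩ : ∃ β γ, ℓ = ![0, β, γ] :=
      ⟨ℓ 1, ℓ 2, by ext i; fin_cases i <;> simp [hp]⟩
    obtain ⟨-, hγ, he⟩ := (htheta hℓ).1 hS
    have hfac : (k * β + (m - δ) * γ) * (k * β + (m + δ) * γ) = 0 := by
      linear_combination k * he - γ ^ 2 * hδ
    have key : ∀ ε : ℂ, k * β + ε * γ = 0 →
        dualLine fr.T ![0, β, γ] = dualLine fr.T ![0, -ε, k] := by
      intro ε hε
      rw [← dualLine_smul fr.T hk0, ← dualLine_smul fr.T hγ ![0, -ε, k]]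
      congr 1
      ext i
      fin_cases i
      · simp
      · simp only [Pi.smul_apply, smul_eq_mul, Fin.mk_one, Matrix.cons_val]
        linear_combination hε
      · simp [mul_comm]
    rcases mul_eq_zero.1 hfac with h | h
    · left
      rw [key _ h, neg_sub', neg_sub_neg, ← neg_add_eq_sub]
    · right
      rw [key _ h, neg_add']
  · rintro (rfl | rfl)
    · refine ⟨(htheta (by simp [hk0])).2 ⟨hplus, hk0, ?_⟩, hmem _ _⟩
      linear_combination k * hδ
    · refine ⟨(htheta (by simp [hk0])).2 ⟨hminus, hk0, ?_⟩, hmem _ _⟩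
      linear_combination k * hδ

/-! #### Lines through no node -/

/-- If a conic squared agrees, on a line not through a coordinate point, with a trinodal quartic,
then the line has the shape dictated by square roots of `A`, `B` and `C`. -/
theorem exists_sqrt_of_bitangent {A B C a b c α β γ g₀ g₁ g₂ : ℂ} (hα : α ≠ 0) (hβ : β ≠ 0)
    (hγ : γ ≠ 0) (h : ∀ x y z : ℂ, α * x + β * y + γ * z = 0 →
      γ ^ 4 * (A * y ^ 2 * z ^ 2 + B * x ^ 2 * z ^ 2 + C * x ^ 2 * y ^ 2 +
        2 * x * y * z * (a * x + b * y + c * z)) = (g₀ * x ^ 2 + g₁ * x * y + g₂ * y ^ 2) ^ 2) :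
    ∃ p q r κ : ℂ, p ^ 2 = A ∧ q ^ 2 = B ∧ r ^ 2 = C ∧
      a - q * r = κ * α ∧ b - p * r = κ * β ∧ c - p * q = κ * γ := by
  obtain ⟨q, hq⟩ : ∃ q, g₀ = -q * α * γ := ⟨-g₀ / (α * γ), by field_simp⟩
  obtain ⟨p, hp⟩ : ∃ p, g₂ = -p * β * γ := ⟨-g₂ / (β * γ), by field_simp⟩
  obtain ⟨r, hr⟩ : ∃ r, g₁ = r * γ ^ 2 - p * γ * α - q * γ * β :=
    ⟨(g₁ + p * γ * α + q * γ * β) / γ ^ 2, by field_simp; ring⟩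
  have hline : ∀ x y z : ℂ, α * x + β * y + γ * z = 0 →
      A * y ^ 2 * z ^ 2 + B * x ^ 2 * z ^ 2 + C * x ^ 2 * y ^ 2 +
        2 * x * y * z * (a * x + b * y + c * z) = (p * y * z + q * x * z + r * x * y) ^ 2 := by
    intro x y z hz
    refine mul_left_cancel₀ (pow_ne_zero 4 hγ) ?_
    rw [h x y z hz, show g₀ * x ^ 2 + g₁ * x * y + g₂ * y ^ 2 =
      γ ^ 2 * (p * y * z + q * x * z + r * x * y) by
        rw [hq, hp, hr]; linear_combination -γ * (q * x + p * y) * hz]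
    ring
  have hp2 : p ^ 2 = A := by
    refine mul_left_cancel₀ (pow_ne_zero 2 (mul_ne_zero hβ hγ)) ?_
    linear_combination -hline 0 γ (-β) (by ring)
  have hq2 : q ^ 2 = B := by
    refine mul_left_cancel₀ (pow_ne_zero 2 (mul_ne_zero hα hγ)) ?_
    linear_combination -hline γ 0 (-α) (by ring)
  have hr2 : r ^ 2 = C := by
    refine mul_left_cancel₀ (pow_ne_zero 2 (mul_ne_zero hα hβ)) ?_
    linear_combination -hline β (-α) 0 (by ring)
  have hlin : ∀ x y z : ℂ, α * x + β * y + γ * z = 0 → x ≠ 0 → y ≠ 0 → z ≠ 0 →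
      (a - q * r) * x + (b - p * r) * y + (c - p * q) * z = 0 := by
    intro x y z he hx hy hz
    have := hline x y z he
    rw [← hp2, ← hq2, ← hr2] at this
    refine (mul_eq_zero.1 ?_).resolve_left
      (mul_ne_zero (mul_ne_zero (mul_ne_zero two_ne_zero hx) hy) hz)
    linear_combination this
  have e₁ := hlin (β * γ) (α * γ) (-2 * (α * β)) (by ring) (by simp [*]) (by simp [*])
    (by simp [*])
  have e₂ := hlin (β * γ) (-2 * (α * γ)) (α * β) (by ring) (by simp [*]) (by simp [*])
    (by simp [*])
  refine ⟨p, q, r, (c - p * q) / γ, hp2, hq2, hr2, ?_, ?_, by field_simp⟩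
  · rw [div_mul_eq_mul_div, eq_div_iff hγ]
    refine mul_left_cancel₀ hβ ?_
    linear_combination (2 * e₁ + e₂) / 3
  · rw [div_mul_eq_mul_div, eq_div_iff hγ]
    refine mul_left_cancel₀ hα ?_
    linear_combination (e₁ - e₂) / 3

theorem thetaLineOfType_zero_iff (fr : TrinodalFrame F p₁ p₂ p₃) (hF : F.IsHomogeneous 4)
    (hirr : Irreducible F) (h12 : p₁ ≠ p₂) (h13 : p₁ ≠ p₃) (h23 : p₂ ≠ p₃)
    (hsing : ∀ q, IsSingularAt F q ↔ q = p₁ ∨ q = p₂ ∨ q = p₃) (S : Set P2) :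
    ThetaLineOfType F 0 S ↔ ∃ p q r : ℂ, p ^ 2 = fr.A ∧ q ^ 2 = fr.B ∧ r ^ 2 = fr.C ∧
      S = dualLine fr.T ![fr.a - q * r, fr.b - p * r, fr.c - p * q] := by
  have hiff : ∀ {ℓ : Fin 3 → ℂ}, ℓ 2 ≠ 0 → (ThetaLineOfType F 0 (dualLine fr.T ℓ) ↔
      (∃ g₀ g₁ g₂ : ℂ, ∀ s t : ℂ,
        eval (fr.T ![s * ℓ 2, t * ℓ 2, -s * ℓ 0 - t * ℓ 1]) F =
          (g₀ * s ^ 2 + g₁ * s * t + g₂ * t ^ 2) ^ 2) ∧ ℓ 0 ≠ 0 ∧ ℓ 1 ≠ 0) := by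
    intro ℓ hγ
    have hℓ : ℓ ≠ 0 := by
      rintro rfl
      exact hγ rfl
    rw [fr.thetaLineOfType_iff hF hirr (u := ![ℓ 2, 0, -ℓ 0]) (v := ![0, ℓ 2, -ℓ 1]) hℓ
      (by
        rw [LinearIndependent.pair_iff]
        intro s t he
        have e0 := congrFun he 0
        have e1 := congrFun he 1
        simp [hγ] at e0 e1
        exact ⟨e0, e1⟩)
      (by simp [dotProduct, Fin.sum_univ_three]; ring)
      (by simp [dotProduct, Fin.sum_univ_three]; ring),
      ncard_singular_eq h12 h13 h23 hsing, fr.mem₁, fr.mem₂, fr.mem₃]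
    have hvec : ∀ s t : ℂ, s • ![ℓ 2, 0, -ℓ 0] + t • ![0, ℓ 2, -ℓ 1] =
        ![s * ℓ 2, t * ℓ 2, -s * ℓ 0 - t * ℓ 1] := by
      intro s t
      simp
      ring
    simp only [hvec]
    simp [hγ]
  constructor
  · intro h
    obtain ⟨ℓ, hℓ, rfl⟩ := fr.exists_eq_dualLine h
    have hγ : ℓ 2 ≠ 0 := by
      intro hγ
      have := h.2.2
      rw [ncard_singular_eq h12 h13 h23 hsing, fr.mem₁, fr.mem₂, fr.mem₃] at this
      simp [hγ] at this
    obtain ⟨⟨g₀, g₁, g₂, hg⟩, hα, hβ⟩ := (hiff hγ).1 h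
    obtain ⟨p, q, r, κ, hp, hq, hr, ea, eb, ec⟩ := exists_sqrt_of_bitangent (A := fr.A) (B := fr.B)
      (C := fr.C) (a := fr.a) (b := fr.b) (c := fr.c) (g₀ := g₀) (g₁ := g₁) (g₂ := g₂)
      hα hβ hγ fun x y z hz => by
        have hxy := hg x y
        rw [show -x * ℓ 0 - y * ℓ 1 = z * ℓ 2 by linear_combination -hz, fr.eval_eq] at hxy
        rw [← hxy]
        ring
    refine ⟨p, q, r, hp, hq, hr, ?_⟩
    have hκ : κ ≠ 0 := by
      rintro rfl
      refine fr.a_sq_ne ?_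
      rw [← hq, ← hr]
      linear_combination (fr.a + q * r) * ea
    rw [ea, eb, ec, ← dualLine_smul fr.T hκ ℓ]
    congr 1
    ext i
    fin_cases i <;> simp
  · rintro ⟨p, q, r, hp, hq, hr, rfl⟩
    have hα : fr.a - q * r ≠ 0 := fun h => fr.a_sq_ne (by
      rw [← hq, ← hr]; linear_combination (fr.a + q * r) * h)
    have hβ : fr.b - p * r ≠ 0 := fun h => fr.b_sq_ne (by
      rw [← hp, ← hr]; linear_combination (fr.b + p * r) * h)
    have hγ : fr.c - p * q ≠ 0 := fun h => fr.c_sq_ne (by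
      rw [← hp, ← hq]; linear_combination (fr.c + p * q) * h)
    refine (hiff hγ).2 ⟨?_, hα, hβ⟩
    simp only [Matrix.cons_val]
    generalize hα' : fr.a - q * r = α, hβ' : fr.b - p * r = β, hγ' : fr.c - p * q = γ
    refine ⟨-q * α * γ, -p * γ * α - q * γ * β + r * γ ^ 2, -p * β * γ, fun s t => ?_⟩
    rw [fr.eval_eq, ← hp, ← hq, ← hr, show fr.a = α + q * r by rw [← hα']; ring,
      show fr.b = β + p * r by rw [← hβ']; ring, show fr.c = γ + p * q by rw [← hγ']; ring]
    ring

theorem ncard_thetaLineOfType_zero (fr : TrinodalFrame F p₁ p₂ p₃) (hF : F.IsHomogeneous 4)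
    (hirr : Irreducible F) (h12 : p₁ ≠ p₂) (h13 : p₁ ≠ p₃) (h23 : p₂ ≠ p₃)
    (hsing : ∀ q, IsSingularAt F q ↔ q = p₁ ∨ q = p₂ ∨ q = p₃) :
    {S : Set P2 | ThetaLineOfType F 0 S}.ncard = 4 := by
  obtain ⟨p, hp⟩ := exists_sq fr.A
  obtain ⟨q, hq⟩ := exists_sq fr.B
  obtain ⟨r, hr⟩ := exists_sq fr.C
  have hp0 : p ≠ 0 := by rintro rfl; exact fr.A_ne (by rw [← hp]; ring)
  have hq0 : q ≠ 0 := by rintro rfl; exact fr.B_ne (by rw [← hq]; ring)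
  have hr0 : r ≠ 0 := by rintro rfl; exact fr.C_ne (by rw [← hr]; ring)
  have ha := fr.a_sq_ne
  have hb := fr.b_sq_ne
  rw [← hq, ← hr] at ha
  rw [← hp, ← hr] at hb
  have ha₁ : fr.a - q * r ≠ 0 := fun h => ha (by linear_combination (fr.a + q * r) * h)
  have ha₂ : fr.a + q * r ≠ 0 := fun h => ha (by linear_combination (fr.a - q * r) * h)
  have hb₁ : fr.b - p * r ≠ 0 := fun h => hb (by linear_combination (fr.b + p * r) * h)
  have hb₂ : fr.b + p * r ≠ 0 := fun h => hb (by linear_combination (fr.b - p * r) * h)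
  have hset : {S : Set P2 | ThetaLineOfType F 0 S} =
      {dualLine fr.T ![fr.a - q * r, fr.b - p * r, fr.c - p * q],
       dualLine fr.T ![fr.a - q * r, fr.b + p * r, fr.c + p * q],
       dualLine fr.T ![fr.a + q * r, fr.b - p * r, fr.c + p * q],
       dualLine fr.T ![fr.a + q * r, fr.b + p * r, fr.c - p * q]} := by
    ext S
    simp only [Set.mem_ofPred_eq, Set.mem_insert_iff, Set.mem_singleton_iff,
      fr.thetaLineOfType_zero_iff hF hirr h12 h13 h23 hsing]
    constructor
    · rintro ⟨p', q', r', hp', hq', hr', rfl⟩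
      rw [← hp, sq_eq_sq_iff_eq_or_eq_neg] at hp'
      rw [← hq, sq_eq_sq_iff_eq_or_eq_neg] at hq'
      rw [← hr, sq_eq_sq_iff_eq_or_eq_neg] at hr'
      rcases hp' with rfl | rfl <;> rcases hq' with rfl | rfl <;> rcases hr' with rfl | rfl <;>
        simp
    · rintro (rfl | rfl | rfl | rfl)
      · exact ⟨p, q, r, hp, hq, hr, rfl⟩
      · exact ⟨-p, q, r, by rw [neg_sq, hp], hq, hr, by simp⟩
      · exact ⟨p, -q, r, hp, by rw [neg_sq, hq], hr, by simp⟩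
      · exact ⟨p, q, -r, hp, hq, by rw [neg_sq, hr], by simp⟩
  have hne : ∀ {e x : ℂ} {ℓ m : Fin 3 → ℂ} (i j : Fin 3), e ≠ 0 → x ≠ 0 → ℓ i * m j - ℓ j * m i =
      2 * e * x → dualLine fr.T ℓ ≠ dualLine fr.T m := by
    intro e x ℓ m i j he hx h heq
    exact mul_ne_zero (mul_ne_zero two_ne_zero he) hx
      (by rw [← h, minors_eq_of_dualLine_eq heq i j, sub_self])
  have h12' := hne (ℓ := ![fr.a - q * r, fr.b - p * r, fr.c - p * q])
    (m := ![fr.a - q * r, fr.b + p * r, fr.c + p * q]) 0 1 (mul_ne_zero hp0 hr0) ha₁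
    (by simp only [Matrix.cons_val]; ring)
  have h13' := hne (ℓ := ![fr.a - q * r, fr.b - p * r, fr.c - p * q])
    (m := ![fr.a + q * r, fr.b - p * r, fr.c + p * q]) 1 0 (mul_ne_zero hq0 hr0) hb₁
    (by simp only [Matrix.cons_val]; ring)
  have h14' := hne (ℓ := ![fr.a - q * r, fr.b - p * r, fr.c - p * q])
    (m := ![fr.a + q * r, fr.b + p * r, fr.c - p * q]) 2 0 (mul_ne_zero hq0 hr0)
    (x := fr.c - p * q) (fun h => fr.c_sq_ne (by
      rw [← hp, ← hq]; linear_combination (fr.c + p * q) * h))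
    (by simp only [Matrix.cons_val]; ring)
  have h23' := hne (ℓ := ![fr.a - q * r, fr.b + p * r, fr.c + p * q])
    (m := ![fr.a + q * r, fr.b - p * r, fr.c + p * q]) 2 0 (mul_ne_zero hq0 hr0)
    (x := fr.c + p * q) (fun h => fr.c_sq_ne (by
      rw [← hp, ← hq]; linear_combination (fr.c - p * q) * h))
    (by simp only [Matrix.cons_val]; ring)
  have h24' := hne (ℓ := ![fr.a - q * r, fr.b + p * r, fr.c + p * q])
    (m := ![fr.a + q * r, fr.b + p * r, fr.c - p * q]) 1 0 (mul_ne_zero hq0 hr0) hb₂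
    (by simp only [Matrix.cons_val]; ring)
  have h34' := hne (ℓ := ![fr.a + q * r, fr.b - p * r, fr.c + p * q])
    (m := ![fr.a + q * r, fr.b + p * r, fr.c - p * q]) 0 1 (mul_ne_zero hp0 hr0) ha₂
    (by simp only [Matrix.cons_val]; ring)
  rw [hset, Set.ncard_insert_of_notMem (by simp [h12', h13', h14']),
    Set.ncard_eq_three.2 ⟨_, _, _, h23', h24', h34', rfl⟩]

end TrinodalFrame

theorem ncard_thetaLineOfType_one_eq_add (h12 : p₁ ≠ p₂) (h13 : p₁ ≠ p₃) (h23 : p₂ ≠ p₃)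
    (hsing : ∀ q, IsSingularAt F q ↔ q = p₁ ∨ q = p₂ ∨ q = p₃)
    (h₁ : {S : Set P2 | ThetaLineOfType F 1 S ∧ p₁ ∈ S}.Finite)
    (h₂ : {S : Set P2 | ThetaLineOfType F 1 S ∧ p₂ ∈ S}.Finite)
    (h₃ : {S : Set P2 | ThetaLineOfType F 1 S ∧ p₃ ∈ S}.Finite) :
    {S : Set P2 | ThetaLineOfType F 1 S}.ncard =
      {S : Set P2 | ThetaLineOfType F 1 S ∧ p₁ ∈ S}.ncard +
      {S : Set P2 | ThetaLineOfType F 1 S ∧ p₂ ∈ S}.ncard +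
      {S : Set P2 | ThetaLineOfType F 1 S ∧ p₃ ∈ S}.ncard := by
  have hcard : ∀ S, ThetaLineOfType F 1 S → (p₁ ∈ S ∧ p₂ ∉ S ∧ p₃ ∉ S) ∨
      (p₁ ∉ S ∧ p₂ ∈ S ∧ p₃ ∉ S) ∨ (p₁ ∉ S ∧ p₂ ∉ S ∧ p₃ ∈ S) := by
    intro S hS
    have := hS.2.2
    rw [ncard_singular_eq h12 h13 h23 hsing] at this
    split_ifs at this <;> simp_all
  rw [← Set.ncard_union_eq ?_ h₁ h₂, ← Set.ncard_union_eq ?_ (h₁.union h₂) h₃]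
  · congr 1
    ext S
    have := hcard S
    simp only [Set.mem_union, Set.mem_ofPred_eq]
    tauto
  · rw [Set.disjoint_left]
    intro S hS hS'
    have := hcard S hS'.1
    simp only [Set.mem_union, Set.mem_ofPred_eq] at hS hS'
    tauto
  · rw [Set.disjoint_left]
    intro S hS hS'
    have := hcard S hS'.1
    simp only [Set.mem_ofPred_eq] at hS hS'
    tauto

end Counting

/-- An irreducible plane quartic whose only singularities are three
ordinary nodes (a trinodal quartic) has exactly 4 theta-lines of type 0, exactly 6 of
type 1 (two through each node), and exactly 3 of type 2, namely the lines joining pairs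
of nodes. -/
theorem trinodal_quartic_theta_lines
    (F : MvPolynomial (Fin 3) ℂ) (hF4 : F.IsHomogeneous 4) (hirr : Irreducible F)
    (p₁ p₂ p₃ : P2) (h12 : p₁ ≠ p₂) (h13 : p₁ ≠ p₃) (h23 : p₂ ≠ p₃)
    (h₁ : OrdinaryNode F p₁) (h₂ : OrdinaryNode F p₂) (h₃ : OrdinaryNode F p₃)
    (honly : ∀ q : P2, IsSingularAt F q → q = p₁ ∨ q = p₂ ∨ q = p₃) :
    {S : Set P2 | ThetaLineOfType F 0 S}.ncard = 4 ∧
    {S : Set P2 | ThetaLineOfType F 1 S}.ncard = 6 ∧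
    {S : Set P2 | ThetaLineOfType F 1 S ∧ p₁ ∈ S}.ncard = 2 ∧
    {S : Set P2 | ThetaLineOfType F 1 S ∧ p₂ ∈ S}.ncard = 2 ∧
    {S : Set P2 | ThetaLineOfType F 1 S ∧ p₃ ∈ S}.ncard = 2 ∧
    {S : Set P2 | ThetaLineOfType F 2 S}.ncard = 3 ∧
    (∀ S : Set P2, ThetaLineOfType F 2 S →
      (p₁ ∈ S ∧ p₂ ∈ S) ∨ (p₁ ∈ S ∧ p₃ ∈ S) ∨ (p₂ ∈ S ∧ p₃ ∈ S)) := by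
  have hsing : ∀ q, IsSingularAt F q ↔ q = p₁ ∨ q = p₂ ∨ q = p₃ := by
    refine fun q => ⟨honly q, ?_⟩
    rintro (rfl | rfl | rfl)
    exacts [h₁.1.1, h₂.1.1, h₃.1.1]
  obtain ⟨fr⟩ := nonempty_trinodalFrame hF4 hirr h12 h13 h23 h₁ h₂ h₃
  obtain ⟨fr₂⟩ := nonempty_trinodalFrame hF4 hirr h12.symm h23 h13 h₂ h₁ h₃
  obtain ⟨fr₃⟩ := nonempty_trinodalFrame hF4 hirr h13.symm h23.symm h12 h₃ h₁ h₂
  have n₁ := fr.ncard_thetaLineOfType_one hF4 hirr h12 h13 h23 hsing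
  have n₂ := fr₂.ncard_thetaLineOfType_one hF4 hirr h12.symm h23 h13 fun q => by
    rw [hsing, or_left_comm]
  have n₃ := fr₃.ncard_thetaLineOfType_one hF4 hirr h13.symm h23.symm h12 fun q => by
    rw [hsing, ← or_assoc, or_comm]
  refine ⟨fr.ncard_thetaLineOfType_zero hF4 hirr h12 h13 h23 hsing, ?_, n₁, n₂, n₃,
    fr.ncard_thetaLineOfType_two hF4 hirr h12 h13 h23 hsing, fun S hS => ?_⟩
  · rw [ncard_thetaLineOfType_one_eq_add h12 h13 h23 hsing
      (Set.finite_of_ncard_ne_zero (by simp [n₁])) (Set.finite_of_ncard_ne_zero (by simp [n₂]))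
      (Set.finite_of_ncard_ne_zero (by simp [n₃])), n₁, n₂, n₃]
  · have := hS.2.2
    rw [ncard_singular_eq h12 h13 h23 hsing] at this
    split_ifs at this <;> simp_all

end
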